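/- arXiv:2410.02926 — 5 statements merged into one kernel-verified Lean document; each statement's English description precedes it below -/
import Mathlib

section
/- Let K be a field of characteristic p > 0 with [K:K^p] = p^n. Then Br.dim_p(K) ≤ n; that is, every central simple K-algebra A whose period is a power of p satisfies ind(A) divides per(A)^n. -/
open scoped TensorProduct

noncomputable section

/-- `A` is a central simple algebra over the field `K`: it is a finite-dimensional
associative unital `K`-algebra which is simple and has center exactly `K`. -/
def IsCSA (K A : Type) [Field K] [Ring A] [Algebra K A] : Prop :=
  Subalgebra.center K A = ⊥ ∧ IsSimpleRing A ∧ FiniteDimensional K A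

/-- `A` is split over `K`, i.e. isomorphic to a matrix algebra over `K`;
equivalently, its Brauer class is trivial (its index is `1`). -/
def IsSplit (K A : Type) [Field K] [Ring A] [Algebra K A] : Prop :=
  ∃ n : ℕ, 0 < n ∧ Nonempty (A ≃ₐ[K] Matrix (Fin n) (Fin n) K)

/-- `A` and `B` are Brauer (Morita) equivalent over `K`:
`M_n(A) ≅ M_m(B)` for some `n, m > 0`. -/
def BrEquiv (K A B : Type) [Field K] [Ring A] [Algebra K A] [Ring B] [Algebra K B] : Prop :=
  ∃ n m : ℕ, 0 < n ∧ 0 < m ∧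
    Nonempty (Matrix (Fin n) (Fin n) A ≃ₐ[K] Matrix (Fin m) (Fin m) B)

/-- The period of (the Brauer class of) `A`: the least `n > 0` such that the `n`-fold
tensor power of `A` over `K` is split. -/
def period (K A : Type) [Field K] [Ring A] [Algebra K A] : ℕ :=
  sInf {n : ℕ | 0 < n ∧ IsSplit K (⨂[K] _ : Fin n, A)}

/-- The index of (the Brauer class of) `A`: the degree of the division algebra `D`
with `A ≅ M_r(D)` (Artin--Wedderburn), i.e. the square root of `dim_K D`. -/
def index (K A : Type) [Field K] [Ring A] [Algebra K A] : ℕ :=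
  sInf {d : ℕ | ∃ (D : Type) (_ : DivisionRing D) (_ : Algebra K D) (r : ℕ), 0 < r ∧
    Nonempty (A ≃ₐ[K] Matrix (Fin r) (Fin r) D) ∧ Module.finrank K D = d ^ 2}

/-- The subfield `k^p` of `p`-th powers of a field `k` (of characteristic `p`). -/
def pthPowers (k : Type) [Field k] (p : ℕ) : Subfield k :=
  Subfield.closure (Set.range fun x : k => x ^ p)

/-- `[k : k^p]`, the degree of `k` over its subfield of `p`-th powers. -/
def pDegree (k : Type) [Field k] (p : ℕ) : ℕ :=
  Module.finrank (pthPowers k p) k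

section part1
attribute [local instance] TensorProduct.Algebra.module

theorem csa_end_eq (K A : Type) [Field K] [Ring A] [Algebra K A]
    (hc : Subalgebra.center K A = ⊥) (g : Module.End (A ⊗[K] Aᵐᵒᵖ) A) :
    ∃ k : K, ∀ x, g x = k • x := by
  have hl : ∀ a x : A, g (a * x) = a * g x := by
    intro a x
    have := g.map_smul (a ⊗ₜ[K] (1 : Aᵐᵒᵖ)) x
    simpa [TensorProduct.Algebra.smul_def] using this
  have hr : ∀ a x : A, g (x * a) = g x * a := by
    intro a x
    have := g.map_smul ((1 : A) ⊗ₜ[K] (MulOpposite.op a)) x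
    simpa [TensorProduct.Algebra.smul_def] using this
  have hz : g 1 ∈ Subalgebra.center K A := by
    rw [Subalgebra.mem_center_iff]
    intro b
    rw [← hl, ← hr]; simp
  rw [hc, Algebra.mem_bot] at hz
  obtain ⟨k, hk⟩ := hz
  refine ⟨k, fun x => ?_⟩
  rw [← one_mul x, hr, ← hk, Algebra.smul_def, one_mul]

theorem csa_simple_module (K A : Type) [Field K] [Ring A] [Algebra K A]
    [IsSimpleRing A] : IsSimpleModule (A ⊗[K] Aᵐᵒᵖ) A := by
  refine { exists_pair_ne := ⟨⊥, ⊤, bot_ne_top⟩, eq_bot_or_eq_top := ?_ }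
  intro S
  have hl : ∀ a x : A, x ∈ S → a * x ∈ S := by
    intro a x hx
    have := S.smul_mem (a ⊗ₜ[K] (1 : Aᵐᵒᵖ)) hx
    simpa [TensorProduct.Algebra.smul_def] using this
  have hr : ∀ a x : A, x ∈ S → x * a ∈ S := by
    intro a x hx
    have := S.smul_mem ((1 : A) ⊗ₜ[K] (MulOpposite.op a)) hx
    simpa [TensorProduct.Algebra.smul_def] using this
  by_cases h : S = ⊥
  · exact Or.inl h
  right
  obtain ⟨x, hx, hx0⟩ := Submodule.exists_mem_ne_zero_of_ne_bot h
  let I : TwoSidedIdeal A := TwoSidedIdeal.mk' (S : Set A) S.zero_mem (fun a b => S.add_mem a b)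
    (fun a => by simpa using S.neg_mem a) (fun {a b} hb => hl a b hb) (fun {a b} ha => hr b a ha)
  have hI : I = ⊤ := by
    rcases eq_bot_or_eq_top I with h | h
    · exfalso
      have : x ∈ I := by simpa [I, TwoSidedIdeal.mem_mk'] using hx
      rw [h] at this
      exact hx0 (by simpa using this)
    · exact h
  rw [eq_top_iff]
  intro y _
  have : y ∈ I := by rw [hI]; trivial
  simpa [I, TwoSidedIdeal.mem_mk'] using this

theorem csa_density (K A : Type) [Field K] [Ring A] [Algebra K A]
    (hc : Subalgebra.center K A = ⊥) [IsSimpleRing A] (f : A →ₗ[K] A) (s : Finset A) :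
    ∃ u : A ⊗[K] Aᵐᵒᵖ, ∀ m ∈ s, f m = AlgHom.mulLeftRight K A u m := by
  have := csa_simple_module K A
  let f' : Module.End (Module.End (A ⊗[K] Aᵐᵒᵖ) A) A :=
    { toFun := f, map_add' := f.map_add, map_smul' := by
        intro g x
        obtain ⟨k, hk⟩ := csa_end_eq K A hc g
        simp [hk] }
  obtain ⟨r, hr⟩ := jacobson_density f' s
  refine ⟨r, fun m hm => ?_⟩
  exact hr m hm

end part1

theorem csa_baseChange_simple (K A L : Type) [Field K] [Ring A] [Algebra K A]
    (hc : Subalgebra.center K A = ⊥) [IsSimpleRing A] [FiniteDimensional K A]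
    [Field L] [Algebra K L] : IsSimpleRing (L ⊗[K] A) := by
  classical
  have hnt : Nontrivial (L ⊗[K] A) := inferInstance
  refine ⟨⟨?_⟩⟩
  intro I
  by_cases h : I = ⊥
  · exact Or.inl h
  right
  obtain ⟨t, ht, ht0⟩ : ∃ t ∈ I, t ≠ 0 := by
    by_contra! hh
    exact h (eq_bot_iff.2 fun x hx => by simpa using hh x hx)
  let b := Module.finBasis K A
  let B := b.baseChange L
  obtain ⟨i0, hi0⟩ : ∃ i, B.repr t i ≠ 0 := by
    by_contra! hh
    exact ht0 (B.repr.map_eq_zero_iff.1 (Finsupp.ext hh))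
  let f : A →ₗ[K] A := (b.coord i0).smulRight 1
  obtain ⟨u, hu⟩ := csa_density K A hc f (Finset.univ.image b)
  have key : ∀ u : A ⊗[K] Aᵐᵒᵖ, ∀ t ∈ I,
      LinearMap.baseChange L (AlgHom.mulLeftRight K A u) t ∈ I := by
    intro u t ht
    induction u with
    | zero => simp [I.zero_mem]
    | add x y hx hy => 
      simp only [map_add, LinearMap.baseChange_add, LinearMap.add_apply]
      exact I.add_mem hx hy
    | tmul x y =>
      have : ∀ t, LinearMap.baseChange L (AlgHom.mulLeftRight K A (x ⊗ₜ y)) t =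
          ((1 : L) ⊗ₜ[K] x) * t * ((1:L) ⊗ₜ[K] y.unop) := by
        intro t
        induction t with
        | zero => simp
        | add a b ha hb => rw [map_add, ha, hb, mul_add, add_mul]
        | tmul a b => simp
      rw [this]
      exact I.mul_mem_right _ _ (I.mul_mem_left _ _ ht)
  have h1 := key u t ht
  have h2 : LinearMap.baseChange L (AlgHom.mulLeftRight K A u) t = 
     (algebraMap L (L ⊗[K] A)) (B.repr t i0) := by
    have : LinearMap.baseChange L (AlgHom.mulLeftRight K A u) = 
      (B.coord i0).smulRight (1 : L ⊗[K] A) := by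
      apply B.ext
      intro i
      have := hu (b i) (by simp)
      simp only [B, Module.Basis.baseChange_apply, LinearMap.baseChange_tmul, ← this, f]
      by_cases hi : i = i0
      · subst hi; simp [Algebra.TensorProduct.one_def]
      · simp [Algebra.TensorProduct.one_def, hi]
    rw [this]
    simp [Algebra.algebraMap_eq_smul_one]
  rw [h2] at h1
  have hun : IsUnit ((algebraMap L (L ⊗[K] A)) (B.repr t i0)) := 
    (IsUnit.mk0 _ hi0).map _
  obtain ⟨v, hv⟩ := hun
  have : (1 : L ⊗[K] A) ∈ I := by
    have := I.mul_mem_left (↑v⁻¹) _ h1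
    rwa [← hv, Units.inv_mul] at this
  exact I.one_mem_iff.1 this

theorem csa_baseChange_central (K A L : Type) [Field K] [Ring A] [Algebra K A]
    (hc : Subalgebra.center K A = ⊥) 
    [Field L] [Algebra K L] : Algebra.IsCentral L (L ⊗[K] A) := by
  constructor
  intro x hx
  have h1 : x ∈ Subalgebra.centralizer K
      (Algebra.TensorProduct.includeRight : A →ₐ[K] L ⊗[K] A).range := by
    rw [Subalgebra.mem_centralizer_iff]
    intro y _
    exact (Subalgebra.mem_center_iff.1 hx y)
  rw [Subalgebra.centralizer_range_includeRight_eq_center_tensorProduct] at h1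
  obtain ⟨y, rfl⟩ := h1
  clear hx
  induction y with
  | zero => simp
  | add a b ha hb =>
    rw [map_add]
    exact Subalgebra.add_mem _ ha hb
  | tmul a b =>
    obtain ⟨b, hb⟩ := b
    rw [hc] at hb
    obtain ⟨k, rfl⟩ := Algebra.mem_bot.1 hb
    refine Algebra.mem_bot.2 ⟨k • a, ?_⟩
    simp [Algebra.algebraMap_eq_smul_one, Algebra.TensorProduct.one_def, TensorProduct.smul_tmul']

theorem sepClosed_division (L D : Type) [Field L] [IsSepClosed L] [DivisionRing D] [Algebra L D]
    [FiniteDimensional L D] [Algebra.IsCentral L D] : Function.Bijective (algebraMap L D) := by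
  refine ⟨(algebraMap L D).injective, ?_⟩
  by_contra hs
  have hneq : (⊥ : Subalgebra L D) ≠ ⊤ := by
    intro h
    apply hs
    intro x
    have : x ∈ (⊤ : Subalgebra L D) := trivial
    rw [← h] at this
    exact Algebra.mem_bot.1 this
  obtain ⟨x, hx, hsep⟩ := JacobsonNoether.exists_separable_and_not_isCentral' hneq
  have hint : IsIntegral L x := Algebra.IsIntegral.isIntegral x
  have hdeg : (minpoly L x).degree ≠ 0 := (minpoly.degree_pos hint).ne'
  obtain ⟨r, hr⟩ := IsSepClosed.exists_root (minpoly L x) hdeg hsep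
  have hirr : Irreducible (minpoly L x) := minpoly.irreducible hint
  have := minpoly.mem_range_of_degree_eq_one L x (Polynomial.degree_eq_one_of_irreducible_of_root hirr hr)
  exact hx (Algebra.mem_bot.2 this)

theorem csa_split_sepClosed (K A L : Type) [Field K] [Ring A] [Algebra K A]
    (hc : Subalgebra.center K A = ⊥) [IsSimpleRing A] [FiniteDimensional K A]
    [Field L] [Algebra K L] [IsSepClosed L] :
    ∃ d : ℕ, 0 < d ∧ Module.finrank K A = d ^ 2 ∧
      Nonempty ((L ⊗[K] A) ≃ₐ[L] Matrix (Fin d) (Fin d) L) := by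
  have := csa_baseChange_simple K A L hc
  have := csa_baseChange_central K A L hc
  have : IsArtinianRing (L ⊗[K] A) := IsArtinianRing.of_finite L _
  obtain ⟨d, hd, D, _, _, _, ⟨e⟩⟩ := 
    IsSimpleRing.exists_algEquiv_matrix_divisionRing_finite L (L ⊗[K] A)
  have : Algebra.IsCentral L (Matrix (Fin d) (Fin d) D) := Algebra.IsCentral.of_algEquiv L _ _ e
  have : Algebra.IsCentral L D := by
    constructor
    intro x hx
    have hm : Matrix.scalar (Fin d) x ∈ Subalgebra.center L (Matrix (Fin d) (Fin d) D) := by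
      rw [Subalgebra.mem_center_iff]
      intro M
      have := Matrix.scalar_commute x (fun r => (Subalgebra.mem_center_iff.1 hx r).symm) M
      exact this.symm
    obtain ⟨l, hl⟩ := Algebra.mem_bot.1 (Algebra.IsCentral.out hm)
    refine Algebra.mem_bot.2 ⟨l, ?_⟩
    have := congrFun (congrFun hl 0) 0
    simpa [Matrix.algebraMap_matrix_apply] using this
  let e2 : D ≃ₐ[L] L := .symm <| .ofBijective (Algebra.ofId L D) (sepClosed_division L D)
  let e3 := e.trans e2.mapMatrix
  refine ⟨d, Nat.pos_of_ne_zero hd.out, ?_, ⟨e3⟩⟩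
  have h1 := e3.toLinearEquiv.finrank_eq
  rw [Module.finrank_baseChange, Module.finrank_matrix] at h1
  simpa [sq] using h1

theorem rank_map_field {F L : Type} [Field F] [Field L] [Algebra F L] {n : Type} [Fintype n] [DecidableEq n]
    (M : Matrix n n F) : (M.map (algebraMap F L)).rank = M.rank := by
  classical
  obtain ⟨l, l', D, h⟩ := Matrix.Pivot.exists_list_transvec_mul_diagonal_mul_list_transvec M
  have hu : IsUnit ((l.map Matrix.TransvectionStruct.toMatrix).prod).det := by
    rw [Matrix.TransvectionStruct.det_toMatrix_prod]; exact isUnit_one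
  have hu' : IsUnit ((l'.map Matrix.TransvectionStruct.toMatrix).prod).det := by
    rw [Matrix.TransvectionStruct.det_toMatrix_prod]; exact isUnit_one
  have hmap : ∀ U : Matrix n n F, IsUnit U.det → IsUnit (U.map (algebraMap F L)).det := by
    intro U hU
    have := hU.map (algebraMap F L)
    rwa [RingHom.map_det] at this
  rw [h, Matrix.map_mul, Matrix.map_mul, Matrix.rank_mul_eq_left_of_isUnit_det _ _ (hmap _ hu'),
    Matrix.rank_mul_eq_right_of_isUnit_det _ _ (hmap _ hu),
    Matrix.rank_mul_eq_left_of_isUnit_det _ _ (hu'),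
    Matrix.rank_mul_eq_right_of_isUnit_det _ _ (hu), Matrix.diagonal_map (by simp)]
  rw [Matrix.rank_diagonal, Matrix.rank_diagonal]
  simp

theorem exists_reps {S : Type} (p : ℕ) [hp : Fact p.Prime] (π : Equiv.Perm S) (hπ : π ^ p = 1) :
    ∃ c : S → ℕ, (∀ s, π s = s → c s = 0) ∧
      ∀ s, π s ≠ s → ∑ k ∈ Finset.range p, c ((π ^ k) s) = 1 := by
  classical
  let rep : S → S := fun s => (Quotient.mk (Equiv.Perm.SameCycle.setoid π) s).out
  have hrep : ∀ s, π.SameCycle (rep s) s := fun s =>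
    Quotient.exact (s := Equiv.Perm.SameCycle.setoid π) (Quotient.out_eq _)
  have hrep2 : ∀ s t, π.SameCycle s t → rep s = rep t := by
    intro s t h
    have : (Quotient.mk (Equiv.Perm.SameCycle.setoid π) s) = Quotient.mk _ t := Quotient.sound h
    simp only [rep, this]
  refine ⟨fun s => if π s ≠ s ∧ rep s = s then 1 else 0, fun s hs => by simp [hs], fun s hs => ?_⟩
  have hnf : ∀ k : ℕ, π ((π ^ k) s) ≠ (π ^ k) s := by
    intro k h
    rw [← Equiv.Perm.mul_apply, ← pow_succ', pow_succ, Equiv.Perm.mul_apply] at h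
    exact hs ((π ^ k).injective h)
  have hsc : ∀ k : ℕ, rep ((π ^ k) s) = rep s := by
    intro k
    exact hrep2 _ _ ((Equiv.Perm.sameCycle_pow_left (n := k)).2 (Equiv.Perm.SameCycle.refl _ _))
  have hper : Function.IsPeriodicPt π p s := by
    have : (π ^ p) s = s := by rw [hπ]; rfl
    rwa [← Equiv.Perm.iterate_eq_pow] at this
  have hmin : Function.minimalPeriod π s = p := by
    rcases (Nat.dvd_prime hp.out).1 hper.minimalPeriod_dvd with h | h
    · exact absurd (Function.minimalPeriod_eq_one_iff_isFixedPt.1 h) hs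
    · exact h
  obtain ⟨k0, hk0, hk⟩ : ∃ k < p, (π ^ k) s = rep s := by
    obtain ⟨i, hi⟩ := (hrep s).symm
    refine ⟨(i % p).toNat, ?_, ?_⟩
    · have := Int.emod_lt_of_pos i (by exact_mod_cast hp.out.pos : (0:ℤ) < p)
      have := Int.emod_nonneg i (by exact_mod_cast hp.out.ne_zero : (p:ℤ) ≠ 0)
      omega
    · have h0 := Int.emod_nonneg i (by exact_mod_cast hp.out.ne_zero : (p:ℤ) ≠ 0)
      rw [← hi, ← zpow_natCast, Int.toNat_of_nonneg h0]
      conv_rhs => rw [← Int.emod_add_mul_ediv i p, zpow_add, zpow_mul, zpow_natCast, hπ]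
      simp
  rw [Finset.sum_eq_single k0]
  · exact if_pos ⟨hnf k0, by rw [hsc, hk]⟩
  · intro b hb hne
    refine if_neg ?_
    rintro ⟨-, h⟩
    rw [hsc, ← hk] at h
    have hinj := Function.iterate_injOn_Iio_minimalPeriod (f := π) (x := s)
    rw [hmin] at hinj
    apply hne
    apply hinj (Finset.mem_range.1 hb) hk0
    simp only [Equiv.Perm.iterate_eq_pow]
    exact h.symm
  · intro h
    exact absurd (Finset.mem_range.2 hk0) h

theorem perm_rank {F : Type} [Field F] (p : ℕ) [hp : Fact p.Prime] [CharP F p]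
    {X : Type} [Fintype X] [DecidableEq X] (π : Equiv.Perm X) (hπ : π ^ p = 1) :
    Module.finrank F (LinearMap.range (LinearMap.funLeft F F π - 1)) +
    Module.finrank F (LinearMap.range (∑ k ∈ Finset.range p, (LinearMap.funLeft F F π) ^ k))
     + Fintype.card {x // π x = x} = Fintype.card X := by
  set Q := LinearMap.funLeft F F π with hQ
  have hQk : ∀ (k : ℕ) (f : X → F) x, (Q ^ k) f x = f ((π ^ k) x) := by
    intro k
    induction k with
    | zero => intro f x; simp
    | succ k ih => 
      intro f x
      rw [pow_succ', Module.End.mul_apply, hQ, LinearMap.funLeft_apply, ← hQ, ih, pow_succ]; rfl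
  obtain ⟨c, hc0, hc1⟩ := exists_reps p π hπ
  have hker : ∀ f, f ∈ LinearMap.ker (Q - 1) ↔ ∀ x, f (π x) = f x := by
    intro f
    rw [LinearMap.mem_ker, LinearMap.sub_apply, sub_eq_zero, funext_iff]
    rfl
  have hkerk : ∀ f, f ∈ LinearMap.ker (Q - 1) → ∀ (k : ℕ) x, f ((π ^ k) x) = f x := by
    intro f hf k
    induction k with
    | zero => simp
    | succ k ih => intro x; rw [pow_succ', Equiv.Perm.mul_apply, (hker f).1 hf, ih]
  let r : LinearMap.ker (Q - 1) →ₗ[F] ({x // π x = x} → F) :=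
    (LinearMap.funLeft F F (Subtype.val)).comp (LinearMap.ker (Q - 1)).subtype
  have hsurj : LinearMap.range r = ⊤ := by
    rw [LinearMap.range_eq_top]
    intro g
    refine ⟨⟨fun x => if h : π x = x then g ⟨x, h⟩ else 0, ?_⟩, ?_⟩
    · rw [hker]
      intro x
      by_cases h : π x = x
      · simp [h]
      · simp [h]
    · ext ⟨x, hx⟩
      simp [r, LinearMap.funLeft_apply, hx]
  have hkr : Submodule.map (LinearMap.ker (Q - 1)).subtype (LinearMap.ker r) = 
      LinearMap.range (∑ k ∈ Finset.range p, Q ^ k) := by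
    ext f
    constructor
    · rintro ⟨⟨g, hg⟩, hgr, rfl⟩
      refine ⟨fun x => c x * g x, ?_⟩
      ext x
      simp only [LinearMap.sum_apply, Finset.sum_apply, hQk, hkerk g hg]
      by_cases h : π x = x
      · have : g x = 0 := congrFun (LinearMap.mem_ker.1 hgr) ⟨x, h⟩
        simp [this]
      · rw [← Finset.sum_mul, ← Nat.cast_sum, hc1 x h]; simp
    · rintro ⟨g, rfl⟩
      have hm : (∑ k ∈ Finset.range p, Q ^ k) g ∈ LinearMap.ker (Q - 1) := by
        rw [LinearMap.mem_ker, ← Module.End.mul_apply, mul_geom_sum]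
        ext x
        rw [LinearMap.sub_apply, Pi.sub_apply, hQk, hπ]
        simp
      refine ⟨⟨_, hm⟩, ?_, rfl⟩
      rw [SetLike.mem_coe, LinearMap.mem_ker]
      ext ⟨x, hx⟩
      have : ∀ k : ℕ, (π ^ k) x = x := by
        intro k
        induction k with
        | zero => rfl
        | succ k ih => rw [pow_succ', Equiv.Perm.mul_apply, ih, hx]
      simp [r, LinearMap.funLeft_apply, hQk, this]
  have e1 := LinearMap.finrank_range_add_finrank_ker (Q - 1)
  have e2 := LinearMap.finrank_range_add_finrank_ker r
  rw [hsurj, finrank_top] at e2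
  rw [← hkr, Submodule.finrank_map_subtype_eq]
  simp at e1 e2 ⊢
  omega

section psi
variable {R A E J : Type} [CommRing R] [Ring A] [Algebra R A] [Ring E] [Algebra R E]
  [Fintype J] [instJ : DecidableEq J]

/-- the product of a commuting family of algebra maps, as a monoid hom -/
def psiHom (f : J → A →ₐ[R] E)
    (hc : Pairwise fun i j => ∀ x y, Commute (f i x) (f j y)) : (J → A) →* E :=
  MonoidHom.noncommPiCoprod (fun j => (f j : A →* E)) hc

theorem psiHom_single (f : J → A →ₐ[R] E)
    (hc : Pairwise fun i j => ∀ x y, Commute (f i x) (f j y)) (j : J) (a : A) :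
    psiHom f hc (Pi.mulSingle j a) = f j a :=
  MonoidHom.noncommPiCoprod_mulSingle (N := fun _ => A) (fun j => (f j : A →* E)) (hcomm := hc) j a

theorem psiHom_update (f : J → A →ₐ[R] E)
    (hc : Pairwise fun i j => ∀ x y, Commute (f i x) (f j y)) (m : J → A) (j : J) (a : A) :
    psiHom f hc (Function.update m j a) = psiHom f hc (Function.update m j 1) * f j a := by
  rw [← psiHom_single f hc, ← map_mul]
  congr 1
  ext k
  by_cases h : k = j
  · subst h; simp
  · simp [h]

/-- the product of a commuting family of algebra maps, as a multilinear map -/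
def psi (f : J → A →ₐ[R] E)
    (hc : Pairwise fun i j => ∀ x y, Commute (f i x) (f j y)) :
    MultilinearMap R (fun _ : J => A) E where
  toFun := psiHom f hc
  map_update_add' := by
    intro inst m j x y
    rw [Subsingleton.elim inst instJ]
    clear inst
    rw [psiHom_update, psiHom_update f hc m j x, psiHom_update f hc m j y, map_add, mul_add]
  map_update_smul' := by
    intro inst m j x y
    rw [Subsingleton.elim inst instJ]
    clear inst
    rw [psiHom_update, psiHom_update f hc m j y, map_smul, mul_smul_comm]

theorem psi_mul (f : J → A →ₐ[R] E)
    (hc : Pairwise fun i j => ∀ x y, Commute (f i x) (f j y)) (a b : J → A) :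
    psi f hc (a * b) = psi f hc a * psi f hc b := map_mul (psiHom f hc) a b

theorem psi_one (f : J → A →ₐ[R] E)
    (hc : Pairwise fun i j => ∀ x y, Commute (f i x) (f j y)) :
    psi f hc 1 = 1 := map_one (psiHom f hc)

theorem psi_single (f : J → A →ₐ[R] E)
    (hc : Pairwise fun i j => ∀ x y, Commute (f i x) (f j y)) (j : J) (a : A) :
    psi f hc (Pi.mulSingle j a) = f j a := psiHom_single f hc j a

theorem mulSingle_comp_perm (s : Equiv.Perm J) (j : J) (a : A) :
    (fun k => (Pi.mulSingle j a : J → A) (s.symm k)) = Pi.mulSingle (s j) a := by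
  ext k
  by_cases h : k = s j
  · subst h; simp
  · rw [Pi.mulSingle_eq_of_ne h, Pi.mulSingle_eq_of_ne]
    intro h'; apply h; rw [← h']; simp

theorem psi_intertwine (f : J → A →ₐ[R] E)
    (hc : Pairwise fun i j => ∀ x y, Commute (f i x) (f j y)) (s : Equiv.Perm J) (σ : E)
    (h : ∀ j a, σ * f j a = f (s j) a * σ) (a : J → A) :
    σ * psi f hc a = psi f hc (fun k => a (s.symm k)) * σ := by
  let S : Submonoid (J → A) :=
    { carrier := {a | σ * psi f hc a = psi f hc (fun k => a (s.symm k)) * σ}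
      one_mem' := by
        change σ * psi f hc 1 = psi f hc 1 * σ
        rw [psi_one]; simp
      mul_mem' := by
        intro a b ha hb
        have : (fun k => (a * b) (s.symm k)) = 
          (fun k => a (s.symm k)) * (fun k => b (s.symm k)) := rfl
        change σ * psi f hc (a * b) = psi f hc (fun k => (a * b) (s.symm k)) * σ
        change σ * psi f hc a = psi f hc (fun k => a (s.symm k)) * σ at ha
        change σ * psi f hc b = psi f hc (fun k => b (s.symm k)) * σ at hb
        rw [psi_mul, this, psi_mul, ← mul_assoc, ha, mul_assoc, hb, mul_assoc] }
  have : a ∈ S := by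
    rw [← Finset.noncommProd_mulSingle a]
    apply Submonoid.noncommProd_mem
    intro j _
    change σ * psi f hc _ = psi f hc _ * σ
    rw [mulSingle_comp_perm, psi_single, psi_single, h]
  exact this

end psi

section mu
variable {L X : Type} [Field L] [Fintype X] [DecidableEq X] {N : ℕ}

theorem mu_basis (x0 : X) (E : X → X → Matrix (Fin N) (Fin N) L) (hN : N = Fintype.card X)
    (hmul : ∀ x y z w, E x y * E z w = if y = z then E x w else 0)
    (hone : ∑ x, E x x = 1) :
    ∃ w : Module.Basis X L (Fin N → L), ∀ x y z, (E x y).mulVec (w z) = if y = z then w x else 0 := by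
  have hNpos : 0 < N := by rw [hN]; exact Fintype.card_pos_iff.2 ⟨x0⟩
  have hne : E x0 x0 ≠ 0 := by
    intro h
    have : (1 : Matrix (Fin N) (Fin N) L) = 0 := by
      rw [← hone]
      apply Finset.sum_eq_zero
      intro x _
      have h1 : E x x = E x x0 * E x0 x0 * E x0 x := by simp [hmul]
      rw [h1, h]; simp
    have := congrFun (congrFun this ⟨0, hNpos⟩) ⟨0, hNpos⟩
    simp at this
  obtain ⟨v, hv⟩ : ∃ v, (E x0 x0).mulVec v ≠ 0 := by
    by_contra! hh
    apply hne
    apply Matrix.toLin'.injective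
    exact LinearMap.ext fun v => by simp [hh]
  let w : X → Fin N → L := fun x => (E x x0).mulVec v
  have hw : ∀ x y z, (E x y).mulVec (w z) = if y = z then w x else 0 := by
    intro x y z
    simp only [w, Matrix.mulVec_mulVec, hmul]
    split_ifs <;> simp
  have hli : LinearIndependent L w := by
    rw [Fintype.linearIndependent_iff]
    intro g hg x
    have := congrArg (fun u => (E x0 x).mulVec u) hg
    simp only [Matrix.mulVec_sum, Matrix.mulVec_smul, hw, Matrix.mulVec_zero] at this
    simp at this
    rcases this with h | h
    · exact h
    · exact absurd h hv
  have : Nonempty X := ⟨x0⟩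
  refine ⟨basisOfLinearIndependentOfCardEqFinrank hli (by simp [hN]), ?_⟩
  simpa using hw

theorem mu_scalar (x0 : X) (E : X → X → Matrix (Fin N) (Fin N) L)
    (w : Module.Basis X L (Fin N → L))
    (hw : ∀ x y z, (E x y).mulVec (w z) = if y = z then w x else 0)
    (σ : Matrix (Fin N) (Fin N) L) (hσ : ∀ x y, σ * E x y = E x y * σ) : ∃ l : L, σ = l • 1 := by
  have h0 : ∃ l : L, σ.mulVec (w x0) = l • w x0 := by
    refine ⟨w.repr (σ.mulVec (w x0)) x0, ?_⟩
    have h1 : (E x0 x0).mulVec (σ.mulVec (w x0)) = σ.mulVec (w x0) := by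
      rw [Matrix.mulVec_mulVec, ← hσ, ← Matrix.mulVec_mulVec, hw]; simp
    have h2 := congrArg (E x0 x0).mulVec (w.sum_repr (σ.mulVec (w x0)))
    rw [h1] at h2
    rw [← h2]
    simp only [Matrix.mulVec_sum, Matrix.mulVec_smul, hw]
    simp [h2]
  obtain ⟨l, hl⟩ := h0
  refine ⟨l, ?_⟩
  apply Matrix.toLin'.injective
  apply w.ext
  intro x
  have hx : w x = (E x x0).mulVec (w x0) := by simp [hw]
  rw [Matrix.toLin'_apply, hx, Matrix.mulVec_mulVec, hσ, ← Matrix.mulVec_mulVec, hl]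
  simp [Matrix.mulVec_smul, Matrix.smul_mulVec]

theorem mu_rank (p : ℕ) [Fact p.Prime] [CharP L p] (w : Module.Basis X L (Fin N → L))
    (π : Equiv.Perm X) (hπ : π ^ p = 1) (P : Matrix (Fin N) (Fin N) L)
    (hP : ∀ x, P.mulVec (w x) = w (π x)) :
    (P - 1).rank + (∑ k ∈ Finset.range p, P ^ k).rank + Fintype.card {x // π x = x} =
      Fintype.card X := by
  let Φ : Matrix (Fin N) (Fin N) L ≃ₐ[L] Module.End L (X → L) :=
    Matrix.toLinAlgEquiv'.trans (w.equivFun.conjAlgEquiv L)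
  have hΦ : ∀ M, Φ M = w.equivFun.toLinearMap ∘ₗ Matrix.toLin' M ∘ₗ w.equivFun.symm.toLinearMap := by
    intro M; rfl
  have hrank : ∀ M, M.rank = Module.finrank L (LinearMap.range (Φ M)) := by
    intro M
    rw [hΦ, LinearMap.range_comp, LinearMap.range_comp, LinearEquiv.range, Submodule.map_top]
    exact (LinearEquiv.finrank_map_eq w.equivFun _).symm
  have hΦP : Φ P = LinearMap.funLeft L L (π⁻¹ : Equiv.Perm X) := by
    rw [hΦ]
    apply (Pi.basisFun L X).ext
    intro x
    ext y
    simp [Module.Basis.equivFun_symm_apply, hP, LinearMap.funLeft_apply, Pi.single_apply,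
      Finsupp.single_apply]
    congr 1
    rw [Equiv.symm_apply_eq]
    exact propext eq_comm
  have hs1 : Φ (P - 1) = LinearMap.funLeft L L (π⁻¹ : Equiv.Perm X) - 1 := by
    rw [map_sub, map_one, hΦP]
  have hs2 : Φ (∑ k ∈ Finset.range p, P ^ k) =
      ∑ k ∈ Finset.range p, (LinearMap.funLeft L L (π⁻¹ : Equiv.Perm X)) ^ k := by
    rw [map_sum]
    exact Finset.sum_congr rfl fun k _ => by rw [map_pow, hΦP]
  rw [hrank (P - 1), hrank (∑ k ∈ Finset.range p, P ^ k), hs1, hs2]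
  have := perm_rank (F := L) p (π⁻¹) (by rw [inv_pow, hπ, inv_one])
  rw [← this]
  congr 1
  apply Fintype.card_congr
  apply Equiv.subtypeEquivRight
  intro x
  rw [Equiv.Perm.inv_eq_iff_eq]
  exact eq_comm

end mu

theorem L_thm {L J : Type} [Field L] [Fintype J] [DecidableEq J] {d N : ℕ} (hd : 0 < d)
    (hN : N = d ^ Fintype.card J) (p : ℕ) [hp : Fact p.Prime] [CharP L p]
    (g : J → Matrix (Fin d) (Fin d) L →ₐ[L] Matrix (Fin N) (Fin N) L)
    (hc : Pairwise fun i j => ∀ x y, Commute (g i x) (g j y))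
    (s : Equiv.Perm J) (hs : s ^ p = 1) :
    ∃ P : Matrix (Fin N) (Fin N) L, P ^ p = 1 ∧ (∀ j a, P * g j a = g (s j) a * P) ∧
      (∀ σ, (∀ j a, σ * g j a = g (s j) a * σ) → ∃ l : L, σ = l • P) ∧
      (P - 1).rank + (∑ k ∈ Finset.range p, P ^ k).rank +
        Fintype.card {x : J → Fin d // ∀ j, x (s j) = x j} = N := by
  let E : (J → Fin d) → (J → Fin d) → Matrix (Fin N) (Fin N) L :=
    fun x y => psi g hc (fun j => Matrix.single (x j) (y j) 1)
  let π : Equiv.Perm (J → Fin d) := Equiv.arrowCongr s (Equiv.refl _)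
  have hπ : ∀ x, π x = fun j => x (s.symm j) := fun x => rfl
  have hπpow : ∀ (k : ℕ) x, (π ^ k) x = fun j => x ((s ^ k).symm j) := by
    intro k
    induction k with
    | zero => intro x; rfl
    | succ k ih =>
      intro x
      rw [pow_succ', Equiv.Perm.mul_apply, ih, hπ, pow_succ']
      rfl
  have hπp : π ^ p = 1 := by
    ext1 x
    rw [hπpow, hs]; rfl
  have hmul : ∀ x y z w, E x y * E z w = if y = z then E x w else 0 := by
    intro x y z w
    simp only [E]
    rw [← psi_mul]
    split_ifs with h
    · subst h
      congr 1
      ext1 j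
      simp
    · obtain ⟨j, hj⟩ := Function.ne_iff.1 h
      apply MultilinearMap.map_coord_zero _ j
      simp [hj]
  have hone : ∑ x, E x x = 1 := by
    have := MultilinearMap.map_sum (psi g hc)
      (fun (_ : J) (i : Fin d) => Matrix.single i i (1 : L))
    rw [← this, ← psi_one g hc]
    congr 1
    ext1 j
    simp [Matrix.sum_single_one]
  have hcard : N = Fintype.card (J → Fin d) := by rw [hN]; simp
  let x0 : J → Fin d := fun _ => ⟨0, hd⟩
  obtain ⟨w, hw⟩ := mu_basis x0 E hcard hmul hone
  let P : Matrix (Fin N) (Fin N) L := ∑ x, E (π x) x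
  have hPw : ∀ x, P.mulVec (w x) = w (π x) := by
    intro x
    simp [P, Matrix.sum_mulVec, hw]
  have hPkw : ∀ (k : ℕ) x, (P ^ k).mulVec (w x) = w ((π ^ k) x) := by
    intro k
    induction k with
    | zero => intro x; simp
    | succ k ih =>
      intro x
      rw [pow_succ, ← Matrix.mulVec_mulVec, hPw, ih, pow_succ]; rfl
  have hPp : P ^ p = 1 := by
    apply Matrix.toLin'.injective
    apply w.ext
    intro x
    rw [Matrix.toLin'_apply, hPkw, hπp]
    simp
  have hPE : ∀ x y, P * E x y = E (π x) y := by
    intro x y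
    simp only [P, Finset.sum_mul, hmul]
    simp
  have hEP : ∀ x y, E x (π y) * P = E x y := by
    intro x y
    simp only [P, Finset.mul_sum, hmul]
    simp
  have hpsi : ∀ a : J → Matrix (Fin d) (Fin d) L, P * psi g hc a =
      psi g hc (fun k => a (s.symm k)) * P := by
    have : (LinearMap.mulLeft L P).compMultilinearMap (psi g hc) =
        (LinearMap.mulRight L P).compMultilinearMap
          ((psi g hc).domDomCongr s.symm) := by
      apply Module.Basis.ext_multilinear (fun _ : J => Matrix.stdBasis L (Fin d) (Fin d))
      intro v
      simp only [LinearMap.compMultilinearMap_apply, LinearMap.mulLeft_apply,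
        LinearMap.mulRight_apply, MultilinearMap.domDomCongr_apply]
      have h1 : ∀ j, (Matrix.stdBasis L (Fin d) (Fin d)) (v j) =
        Matrix.single (v j).1 (v j).2 1 := by
        intro j
        rw [← Matrix.stdBasis_eq_single]
      simp only [h1]
      have h2 := hPE (fun j => (v j).1) (fun j => (v j).2)
      have h3 := hEP (π (fun j => (v j).1)) (fun j => (v j).2)
      exact h2.trans h3.symm
    intro a
    have := DFunLike.congr_fun this a
    simpa using this
  have hPPE : ∀ x y, P * E x y = E (π x) (π y) * P := fun x y => by rw [hPE, hEP]
  have hpos : 0 < p := hp.out.pos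
  have hPQ : P * P ^ (p - 1) = 1 := by
    rw [← pow_succ', Nat.sub_add_cancel hpos, hPp]
  have hQP : P ^ (p - 1) * P = 1 := by
    rw [← pow_succ, Nat.sub_add_cancel hpos, hPp]
  refine ⟨P, hPp, ?_, ?_, ?_⟩
  · intro j a
    have := hpsi (Pi.mulSingle j a)
    rwa [mulSingle_comp_perm, psi_single, psi_single] at this
  · intro σ hσ
    have h1 := psi_intertwine g hc s σ hσ
    obtain ⟨l, hl⟩ := mu_scalar x0 E w hw (P ^ (p - 1) * σ) (by
      intro x y
      have h2 : σ * E x y = E (π x) (π y) * σ := h1 _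
      have h3 : P ^ (p - 1) * E (π x) (π y) = E x y * P ^ (p - 1) := by
        calc P ^ (p - 1) * E (π x) (π y) = P ^ (p - 1) * (E (π x) (π y) * P) * P ^ (p - 1) := by
              rw [mul_assoc, mul_assoc, hPQ, mul_one]
          _ = _ := by rw [← hPPE, ← mul_assoc, hQP, one_mul]
      rw [mul_assoc, h2, ← mul_assoc, h3, mul_assoc])
    refine ⟨l, ?_⟩
    have := congrArg (P * ·) hl
    simp only [← mul_assoc, hPQ] at this
    simpa using this
  · have := mu_rank p w π hπp P hPw
    refine Eq.trans ?_ (this.trans hcard.symm)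
    congr 1
    apply Fintype.card_congr
    apply Equiv.subtypeEquivRight
    intro x
    rw [hπ]
    constructor
    · intro h
      ext1 j
      have := h (s.symm j)
      rw [Equiv.apply_symm_apply] at this
      exact this.symm
    · intro h j
      have := congrFun h (s j)
      simpa using this.symm

theorem descent_P {K F L A J : Type} [Field K] [Field F] [Field L] [Algebra K F] [Algebra F L]
    [Algebra K L] [IsScalarTower K F L] [IsSepClosed L] [Algebra.IsSeparable F L]
    [Ring A] [Algebra K A] [Fintype J] [DecidableEq J] {d N : ℕ} (hd : 0 < d)
    (e : (L ⊗[K] A) ≃ₐ[L] Matrix (Fin d) (Fin d) L)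
    (hN : N = d ^ Fintype.card J) (p : ℕ) [hp : Fact p.Prime] [CharP F p]
    (g : J → A →ₐ[K] Matrix (Fin N) (Fin N) F)
    (hc : Pairwise fun i j => ∀ x y, Commute (g i x) (g j y))
    (s : Equiv.Perm J) (hs : s ^ p = 1) :
    ∃ P : Matrix (Fin N) (Fin N) F, P ^ p = 1 ∧ (∀ j a, P * g j a = g (s j) a * P) ∧
      (P - 1).rank + (∑ k ∈ Finset.range p, P ^ k).rank +
        Fintype.card {x : J → Fin d // ∀ j, x (s j) = x j} = N := by
  haveI : CharP L p := charP_of_injective_algebraMap (algebraMap F L).injective p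
  let μ : Matrix (Fin N) (Fin N) F →ₐ[F] Matrix (Fin N) (Fin N) L := (Algebra.ofId F L).mapMatrix
  have hμ : ∀ M, μ M = M.map (algebraMap F L) := fun M => rfl
  have hμinj : Function.Injective μ := by
    intro M M' h
    ext i j
    exact (algebraMap F L).injective (congrFun (congrFun h i) j)
  let ν : Matrix (Fin N) (Fin N) F →ₐ[K] Matrix (Fin N) (Fin N) L :=
    (IsScalarTower.toAlgHom K F L).mapMatrix
  have hν : ∀ M, ν M = μ M := fun M => rfl
  let g1 : J → (L ⊗[K] A) →ₐ[L] Matrix (Fin N) (Fin N) L := fun j =>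
    Algebra.TensorProduct.lift (Algebra.ofId L _) (ν.comp (g j)) (fun x y => Algebra.commutes _ _)
  have hg1 : ∀ j l a, g1 j (l ⊗ₜ a) = l • μ (g j a) := by
    intro j l a
    simp only [g1, Algebra.TensorProduct.lift_tmul, Algebra.ofId_apply, Algebra.smul_def]
    rfl
  have hg1c : Pairwise fun i j => ∀ x y, Commute (g1 i x) (g1 j y) := by
    intro i j hij x y
    induction x with
    | zero => simp
    | add x x' hx hx' => rw [map_add]; exact hx.add_left hx'
    | tmul l a =>
      induction y with
      | zero => simp
      | add x x' hx hx' => rw [map_add]; exact hx.add_right hx'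
      | tmul l' b =>
        rw [hg1, hg1]
        exact (((hc hij a b).map μ).smul_left l).smul_right l'
  let g2 : J → Matrix (Fin d) (Fin d) L →ₐ[L] Matrix (Fin N) (Fin N) L := fun j =>
    (g1 j).comp e.symm.toAlgHom
  obtain ⟨P, hPp, hPg, hPu, hPr⟩ := L_thm hd hN p g2 (fun i j hij x y => hg1c hij _ _) s hs
  have hPg1 : ∀ j a, P * μ (g j a) = μ (g (s j) a) * P := by
    intro j a
    have := hPg j (e (1 ⊗ₜ a))
    simpa [g2, hg1] using this
  have hNpos : 0 < N := by rw [hN]; positivity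
  have hP0 : P ≠ 0 := by
    rintro rfl
    rw [zero_pow hp.out.ne_zero] at hPp
    have := congrFun (congrFun hPp ⟨0, hNpos⟩) ⟨0, hNpos⟩
    simp at this
  obtain ⟨i, j, hij⟩ : ∃ i j, P i j ≠ 0 := by
    by_contra! h
    exact hP0 (by ext i j; exact h i j)
  obtain ⟨f, hf⟩ : ∃ f : Module.Dual F L, f (P i j) ≠ 0 := by
    by_contra! h
    exact hij ((Module.forall_dual_apply_eq_zero_iff F _).1 h)
  let σ : Matrix (Fin N) (Fin N) F := P.map f
  have hσ0 : σ i j ≠ 0 := hf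
  have hσr : ∀ M, σ * M = (P * μ M).map f := by
    intro M
    ext a b
    simp only [Matrix.mul_apply, Matrix.map_apply, σ, hμ, map_sum]
    refine Finset.sum_congr rfl fun k _ => ?_
    rw [mul_comm (P a k), ← Algebra.smul_def, map_smul, smul_eq_mul, mul_comm]
  have hσl : ∀ M, M * σ = (μ M * P).map f := by
    intro M
    ext a b
    simp only [Matrix.mul_apply, Matrix.map_apply, σ, hμ, map_sum]
    refine Finset.sum_congr rfl fun k _ => ?_
    rw [← Algebra.smul_def, map_smul, smul_eq_mul]
  have hσ : ∀ j a, σ * g j a = g (s j) a * σ := by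
    intro j a
    rw [hσr, hσl, hPg1]
  have hσ1 : ∀ j x, μ σ * g1 j x = g1 (s j) x * μ σ := by
    intro j x
    induction x with
    | zero => simp
    | add x x' hx hx' => rw [map_add, map_add, mul_add, add_mul, hx, hx']
    | tmul l a =>
      rw [hg1, hg1, mul_smul_comm, smul_mul_assoc, ← map_mul, hσ, map_mul]
  obtain ⟨l, hl⟩ := hPu (μ σ) (fun j a => hσ1 j _)
  have hl0 : l ≠ 0 := by
    rintro rfl
    rw [zero_smul] at hl
    have := congrFun (congrFun hl i) j
    simp [hμ] at this
    exact hσ0 this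
  have hlp : μ (σ ^ p) = l ^ p • 1 := by
    rw [map_pow, hl, smul_pow, hPp]
  have hlF : l ∈ perfectClosure F L := by
    rw [mem_perfectClosure_iff_pow_mem p]
    refine ⟨1, ⟨(σ ^ p) ⟨0, hNpos⟩ ⟨0, hNpos⟩, ?_⟩⟩
    have := congrFun (congrFun hlp ⟨0, hNpos⟩) ⟨0, hNpos⟩
    simpa [hμ] using this
  rw [perfectClosure.eq_bot_of_isSeparable, IntermediateField.mem_bot] at hlF
  obtain ⟨l0, rfl⟩ := hlF
  have hl00 : l0 ≠ 0 := by rintro rfl; simp at hl0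
  let Q := l0⁻¹ • σ
  have hQ : μ Q = P := by
    rw [map_smul, hl, ← algebraMap_smul L l0⁻¹ (algebraMap F L l0 • P), smul_smul, ← map_mul,
      inv_mul_cancel₀ hl00, map_one, one_smul]
  refine ⟨Q, hμinj ?_, fun j a => hμinj ?_, ?_⟩
  · rw [map_pow, hQ, hPp, map_one]
  · rw [map_mul, hQ, hPg1, map_mul, hQ]
  · have h1 : (Q - 1).rank = (P - 1).rank := by
      rw [← rank_map_field (L := L), ← hμ, map_sub, hQ, map_one]
    have h2 : (∑ k ∈ Finset.range p, Q ^ k).rank = (∑ k ∈ Finset.range p, P ^ k).rank := by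
      rw [← rank_map_field (L := L), ← hμ, map_sum]
      congr 1
      exact Finset.sum_congr rfl fun k _ => by rw [map_pow, hQ]
    rw [h1, h2]
    convert hPr

/-- the algebra of matrices commuting with `P` acts on `ker (P-1) / im (1+P+...)` -/
theorem quot_action {F : Type} [Field F] {N : ℕ} (p : ℕ) (P : Matrix (Fin N) (Fin N) F)
    (hP : P ^ p = 1) (D : ℕ)
    (hr : (P - 1).rank + (∑ k ∈ Finset.range p, P ^ k).rank + D = N) :
    ∃ ρ : Subalgebra.centralizer F {P} →ₐ[F] Matrix (Fin D) (Fin D) F,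
      ∀ C : Subalgebra.centralizer F {P},
        (∀ w : Fin N → F, P.mulVec w = w →
          ∃ u, C.1.mulVec w = (∑ k ∈ Finset.range p, P ^ k).mulVec u) → ρ C = 0 := by
  set S := ∑ k ∈ Finset.range p, P ^ k with hS
  let W : Submodule F (Fin N → F) := LinearMap.ker (Matrix.toLin' (P - 1))
  let U : Submodule F (Fin N → F) := LinearMap.range (Matrix.toLin' S)
  have hW : ∀ w, w ∈ W ↔ P.mulVec w = w := by
    intro w
    simp only [W, LinearMap.mem_ker, Matrix.toLin'_apply, Matrix.sub_mulVec, Matrix.one_mulVec,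
      sub_eq_zero]
  have hUW : U ≤ W := by
    rintro _ ⟨u, rfl⟩
    rw [LinearMap.mem_ker, Matrix.toLin'_apply, Matrix.toLin'_apply, Matrix.mulVec_mulVec,
      hS, mul_geom_sum, hP]
    simp
  let U' : Submodule F W := U.comap W.subtype
  have hdim : Module.finrank F (W ⧸ U') = D := by
    have h1 : Module.finrank F U' = S.rank := by
      have : Module.finrank F U' = Module.finrank F U :=
        (Submodule.comapSubtypeEquivOfLe hUW).finrank_eq
      rw [this]; rfl
    have h2 := Submodule.finrank_quotient_add_finrank U'
    have h3 := LinearMap.finrank_range_add_finrank_ker (Matrix.toLin' (P - 1))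
    have h4 : Module.finrank F (LinearMap.range (Matrix.toLin' (P - 1))) = (P - 1).rank := rfl
    have h5 : Module.finrank F W = Module.finrank F (LinearMap.ker (Matrix.toLin' (P - 1))) := rfl
    simp at h3
    omega
  have hcomm : ∀ C : Subalgebra.centralizer F {P}, Commute P C.1 := fun C =>
    (Subalgebra.mem_centralizer_iff F).1 C.2 P rfl
  have hCW : ∀ C : Subalgebra.centralizer F {P}, ∀ w ∈ W, Matrix.toLin' C.1 w ∈ W := by
    intro C w hw
    rw [hW] at hw ⊢
    rw [Matrix.toLin'_apply, Matrix.mulVec_mulVec, (hcomm C).eq, ← Matrix.mulVec_mulVec, hw]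
  let r : Subalgebra.centralizer F {P} → Module.End F W := fun C =>
    (Matrix.toLin' C.1).restrict (hCW C)
  have hr' : ∀ C w, ((r C w : W) : Fin N → F) = C.1.mulVec w := fun C w => rfl
  have hrU : ∀ C, U' ≤ U'.comap (r C) := by
    rintro C w ⟨u, hu⟩
    refine ⟨C.1.mulVec u, ?_⟩
    have h1 : Commute S C.1 := by
      rw [hS]
      exact Commute.sum_left _ _ _ fun k _ => (hcomm C).pow_left k
    change (Matrix.toLin' S) (C.1.mulVec u) = C.1.mulVec w
    change (Matrix.toLin' S) u = w at hu
    rw [← hu, Matrix.toLin'_apply, Matrix.toLin'_apply, Matrix.mulVec_mulVec, h1.eq,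
      Matrix.mulVec_mulVec]
  let q : Subalgebra.centralizer F {P} → Module.End F (W ⧸ U') := fun C =>
    U'.mapQ U' (r C) (hrU C)
  have hq : ∀ C w, q C (Submodule.Quotient.mk w) = Submodule.Quotient.mk (r C w) := fun C w => rfl
  have hqext : ∀ f g : Module.End F (W ⧸ U'),
      (∀ w, f (Submodule.Quotient.mk w) = g (Submodule.Quotient.mk w)) → f = g := by
    intro f g h
    apply LinearMap.ext
    intro x
    obtain ⟨w, rfl⟩ := Submodule.Quotient.mk_surjective _ x
    exact h w
  let qa : Subalgebra.centralizer F {P} →ₐ[F] Module.End F (W ⧸ U') :=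
    AlgHom.ofLinearMap
      { toFun := q
        map_add' := by
          intro C C'
          apply hqext
          intro w
          rw [LinearMap.add_apply, hq, hq, hq, ← Submodule.Quotient.mk_add]
          congr 1
          ext1
          simp [hr', Matrix.add_mulVec]
        map_smul' := by
          intro c C
          apply hqext
          intro w
          rw [RingHom.id_apply, LinearMap.smul_apply, hq, hq, ← Submodule.Quotient.mk_smul]
          congr 1
          ext1
          simp [hr', Matrix.smul_mulVec] }
      (by
        apply hqext
        intro w
        change q 1 _ = _
        rw [hq]
        congr 1
        ext1
        simp [hr'])
      (by
        intro C C'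
        apply hqext
        intro w
        rw [Module.End.mul_apply]
        change q (C * C') (Submodule.Quotient.mk w) = q C (q C' (Submodule.Quotient.mk w))
        rw [hq, hq, hq]
        congr 1
        ext1
        simp [hr'])
  let b := Module.finBasisOfFinrankEq F (W ⧸ U') hdim
  refine ⟨(LinearMap.toMatrixAlgEquiv b).toAlgHom.comp qa, fun C hC => ?_⟩
  have : q C = 0 := by
    apply hqext
    intro w
    rw [hq, LinearMap.zero_apply, Submodule.Quotient.mk_eq_zero]
    obtain ⟨u, hu⟩ := hC w ((hW _).1 w.2)
    exact ⟨u, hu.symm⟩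
  change LinearMap.toMatrixAlgEquiv b (q C) = 0
  rw [this, map_zero]

/-- additivity of the diagonal, modulo norms -/
theorem tau_add {K F A : Type} [Field K] [Field F] [Algebra K F] [Ring A] [Algebra K A]
    (p : ℕ) [hp : Fact p.Prime] {N : ℕ} (P : Matrix (Fin N) (Fin N) F)
    (f : ZMod p → A →ₐ[K] Matrix (Fin N) (Fin N) F)
    (hc : Pairwise fun i j => ∀ x y, Commute (f i x) (f j y))
    (hPf : ∀ j a, P * f j a = f (j + 1) a * P) (a b : A) (w : Fin N → F) (hw : P.mulVec w = w) :
    ∃ u, (psi f hc (fun _ => a + b) - psi f hc (fun _ => a) - psi f hc (fun _ => b)).mulVec w =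
      (∑ k ∈ Finset.range p, P ^ k).mulVec u := by
  let s : Equiv.Perm (ZMod p) := Equiv.addRight 1
  have hspow : ∀ (k : ℕ) x, (s ^ k) x = x + k := by
    intro k
    induction k with
    | zero => intro x; simp
    | succ k ih => intro x; rw [pow_succ', Equiv.Perm.mul_apply, ih]; simp [s, add_assoc]
  let π : Equiv.Perm (Finset (ZMod p)) := s.finsetCongr
  have hπ : ∀ S x, x ∈ π S ↔ s.symm x ∈ S := by
    intro S x
    simp only [π, Equiv.finsetCongr_apply, Finset.mem_map_equiv]
  have hπpow : ∀ (k : ℕ) S x, x ∈ (π ^ k) S ↔ (s ^ k).symm x ∈ S := by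
    intro k
    induction k with
    | zero => intro S x; rfl
    | succ k ih =>
      intro S x
      rw [pow_succ', Equiv.Perm.mul_apply, hπ, ih, pow_succ']
      rfl
  have hsp : s ^ p = 1 := by
    ext1 x
    rw [hspow]; simp
  have hπp : π ^ p = 1 := by
    ext1 S
    ext1 x
    rw [hπpow, hsp]; rfl
  have hfix : ∀ S, π S = S ↔ S = ∅ ∨ S = Finset.univ := by
    intro S
    constructor
    · intro h
      rcases S.eq_empty_or_nonempty with h0 | ⟨x, hx⟩
      · exact Or.inl h0
      · right
        have h1 : ∀ k : ℕ, x + k ∈ S := by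
          intro k
          induction k with
          | zero => simpa using hx
          | succ k ih =>
            rw [← h, hπ]
            simpa [s, ← add_assoc, sub_eq_add_neg] using ih
        ext y
        simp only [Finset.mem_univ, iff_true]
        have := h1 (y - x).val
        rw [ZMod.natCast_zmod_val] at this
        simpa using this
    · rintro (rfl | rfl)
      · ext x; simp [hπ]
      · ext x; simp [hπ]
  let X : Finset (ZMod p) → Matrix (Fin N) (Fin N) F := fun S =>
    psi f hc (S.piecewise (fun _ => a) (fun _ => b))
  have hPX : ∀ S, P * X S = X (π S) * P := by
    intro S
    have := psi_intertwine f hc s P hPf (S.piecewise (fun _ => a) (fun _ => b))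
    simp only [X]
    rw [this]
    congr 2
    ext1 k
    by_cases h : s.symm k ∈ S
    · rw [Finset.piecewise_eq_of_mem _ _ _ h, Finset.piecewise_eq_of_mem _ _ _ ((hπ _ _).2 h)]
    · rw [Finset.piecewise_eq_of_notMem _ _ _ h,
        Finset.piecewise_eq_of_notMem _ _ _ (fun h' => h ((hπ _ _).1 h'))]
  have hPkw : ∀ k : ℕ, ∀ S, (P ^ k).mulVec ((X S).mulVec w) = (X ((π ^ k) S)).mulVec w := by
    intro k
    induction k with
    | zero => intro S; simp
    | succ k ih =>
      intro S
      rw [pow_succ', ← Matrix.mulVec_mulVec, ih, Matrix.mulVec_mulVec, hPX,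
        ← Matrix.mulVec_mulVec, hw, pow_succ']
      rfl
  obtain ⟨c, hc0, hc1⟩ := exists_reps p π⁻¹ (by rw [inv_pow, hπp, inv_one])
  have hfix' : ∀ S, π⁻¹ S = S ↔ π S = S := by
    intro S
    rw [Equiv.Perm.inv_eq_iff_eq]; exact eq_comm
  have hsum : psi f hc (fun _ => a + b) = ∑ S, X S := by
    have := MultilinearMap.map_add_univ (psi f hc) (fun _ => a) (fun _ => b)
    exact this
  have hXe : X ∅ = psi f hc (fun _ => b) := by simp [X]
  have hXu : X Finset.univ = psi f hc (fun _ => a) := by simp [X]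
  have hcs : ∀ S, ∑ k ∈ Finset.range p, c (((π⁻¹) ^ k) S) = if π S = S then 0 else 1 := by
    intro S
    split_ifs with h
    · apply Finset.sum_eq_zero
      intro k _
      apply hc0
      rw [hfix']
      have h1 : Commute π ((π⁻¹) ^ k) := ((Commute.refl π).inv_right).pow_right k
      rw [← Equiv.Perm.mul_apply, h1.eq, Equiv.Perm.mul_apply, h]
    · exact hc1 S (by rwa [Ne, hfix'])
  have hmain : (psi f hc (fun _ => a + b) - psi f hc (fun _ => a) - psi f hc (fun _ => b)) =
      ∑ S, (if π S = S then 0 else 1 : ℕ) • X S := by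
    rw [hsum, ← hXe, ← hXu]
    have h1 : ∑ S, X S = ∑ S, (if π S = S then 0 else 1 : ℕ) • X S +
        ∑ S, (if π S = S then X S else 0) := by
      rw [← Finset.sum_add_distrib]
      refine Finset.sum_congr rfl fun S _ => ?_
      split_ifs <;> simp
    have h2 : ∑ S, (if π S = S then X S else 0) = X ∅ + X Finset.univ := by
      rw [← Finset.sum_filter]
      have : (Finset.univ.filter fun S => π S = S) = {∅, Finset.univ} := by
        ext S
        simp [hfix]
      rw [this, Finset.sum_pair Finset.univ_nonempty.ne_empty.symm]
    rw [h1, h2]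
    abel
  refine ⟨∑ S, c S • (X S).mulVec w, ?_⟩
  rw [hmain]
  have e1 : (∑ k ∈ Finset.range p, P ^ k).mulVec (∑ S, c S • (X S).mulVec w) =
      ∑ k ∈ Finset.range p, ∑ S, c S • (X ((π ^ k) S)).mulVec w := by
    rw [Matrix.sum_mulVec]
    refine Finset.sum_congr rfl fun k _ => ?_
    rw [Matrix.mulVec_sum]
    refine Finset.sum_congr rfl fun S _ => ?_
    rw [Matrix.mulVec_smul, hPkw]
  have e2 : ∀ k, ∑ S, c S • (X ((π ^ k) S)).mulVec w =
      ∑ S, c (((π⁻¹) ^ k) S) • (X S).mulVec w := by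
    intro k
    rw [← Equiv.sum_comp (π ^ k) (fun S => c (((π⁻¹) ^ k) S) • (X S).mulVec w)]
    refine Finset.sum_congr rfl fun S _ => ?_
    simp
  rw [e1]
  simp_rw [e2]
  rw [Finset.sum_comm, Matrix.sum_mulVec]
  refine Finset.sum_congr rfl fun S _ => ?_
  rw [← Finset.sum_smul, hcs, Matrix.smul_mulVec]

theorem psi_commute {R A E J : Type} [CommRing R] [Ring A] [Algebra R A] [Ring E] [Algebra R E]
    [Fintype J] [DecidableEq J] (f : J → A →ₐ[R] E)
    (hc : Pairwise fun i j => ∀ x y, Commute (f i x) (f j y)) (σ : E)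
    (h : ∀ j a, σ * f j a = f j a * σ) (a : J → A) :
    σ * psi f hc a = psi f hc a * σ :=
  psi_intertwine f hc 1 σ h a

/-- A commuting family of actions of `A` on a common vector space of the minimal dimension. -/
def HasFam {K F : Type} [Field K] [Field F] (φ : K →+* F) (A : Type) [Ring A] [Algebra K A]
    (d : ℕ) (J : Type) : Prop :=
  ∃ κ : J → A →+* Matrix (Fin (d ^ Nat.card J)) (Fin (d ^ Nat.card J)) F,
    (∀ j c, κ j (algebraMap K A c) = Matrix.scalar _ (φ c)) ∧
    Pairwise fun i j => ∀ x y, Commute (κ i x) (κ j y)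

theorem HasFam.congr {K F : Type} [Field K] [Field F] {φ : K →+* F} {A : Type} [Ring A]
    [Algebra K A] {d : ℕ} {J J' : Type} (e : J' ≃ J) (h : HasFam φ A d J) : HasFam φ A d J' := by
  unfold HasFam at h ⊢
  rw [Nat.card_congr e]
  obtain ⟨κ, h1, h2⟩ := h
  exact ⟨fun j => κ (e j), fun j c => h1 _ c, fun i j hij => h2 (e.injective.ne hij)⟩

theorem HasFam.step {K F : Type} [Field K] [Field F] {φ : K →+* F} {A : Type} [Ring A]
    [Algebra K A] (hcen : Subalgebra.center K A = ⊥) [IsSimpleRing A] [FiniteDimensional K A]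
    {d : ℕ} (hd : 0 < d) (hdim : Module.finrank K A = d ^ 2) (p : ℕ) [hp : Fact p.Prime]
    [CharP F p] {I : Type} [Finite I] (h : HasFam φ A d (I × ZMod p)) :
    HasFam ((frobenius F p).comp φ) A d I := by
  classical
  have := Fintype.ofFinite I
  letI := φ.toAlgebra
  let L := SeparableClosure F
  letI : Algebra K L := ((algebraMap F L).comp φ).toAlgebra
  haveI : IsScalarTower K F L := IsScalarTower.of_algebraMap_eq fun _ => rfl
  obtain ⟨d', hd', hdim', ⟨e⟩⟩ := csa_split_sepClosed K A L hcen
  obtain rfl : d' = d := by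
    rw [hdim] at hdim'
    exact (Nat.pow_left_injective (n := 2) (by norm_num) hdim').symm
  unfold HasFam at h
  generalize hN : d' ^ Nat.card (I × ZMod p) = N at h
  obtain ⟨κ, h1, h2⟩ := h
  let g : I × ZMod p → A →ₐ[K] Matrix (Fin N) (Fin N) F := fun j =>
    { κ j with commutes' := fun c => h1 j c }
  let s : Equiv.Perm (I × ZMod p) := (Equiv.refl I).prodCongr (Equiv.addRight 1)
  have hspow : ∀ (k : ℕ) x, (s ^ k) x = (x.1, x.2 + k) := by
    intro k
    induction k with
    | zero => intro x; simp
    | succ k ih => intro x; rw [pow_succ', Equiv.Perm.mul_apply, ih]; simp [s, add_assoc]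
  have hsp : s ^ p = 1 := by
    ext1 x
    rw [hspow]; simp
  obtain ⟨P, hPp, hPg, hPr⟩ := descent_P hd e (by rw [← hN, Nat.card_eq_fintype_card]) p g h2 s hsp
  have hcard : Fintype.card {x : I × ZMod p → Fin d' // ∀ j, x (s j) = x j} =
      d' ^ Nat.card I := by
    have e : {x : I × ZMod p → Fin d' // ∀ j, x (s j) = x j} ≃ (I → Fin d') :=
      { toFun := fun x i => x.1 (i, 0)
        invFun := fun y => ⟨fun q => y q.1, fun j => rfl⟩
        left_inv := by
          rintro ⟨x, hx⟩
          ext1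
          ext1 ⟨i, k⟩
          have h3 : ∀ m : ℕ, x (i, (m : ZMod p)) = x (i, 0) := by
            intro m
            induction m with
            | zero => simp
            | succ m ih => rw [← ih, ← hx (i, (m : ZMod p))]; simp [s]
          have := h3 k.val
          rw [ZMod.natCast_zmod_val] at this
          exact this.symm
        right_inv := fun y => rfl }
    rw [Fintype.card_congr e]
    simp
  rw [hcard] at hPr
  obtain ⟨ρ, hρ⟩ := quot_action p P hPp _ hPr
  have hci : ∀ i, Pairwise fun k l : ZMod p => ∀ x y, Commute (g (i, k) x) (g (i, l) y) := by
    intro i k l hkl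
    exact h2 (fun h => hkl (congrArg Prod.snd h))
  let τ : I → A → Matrix (Fin N) (Fin N) F := fun i a =>
    psi (fun k => g (i, k)) (hci i) (fun _ => a)
  have hτP : ∀ i a, P * τ i a = τ i a * P := fun i a =>
    psi_intertwine (fun k => g (i, k)) (hci i) (Equiv.addRight 1) P (fun k a => hPg (i, k) a) _
  have hτmem : ∀ i a, τ i a ∈ Subalgebra.centralizer F {P} := by
    intro i a
    rw [Subalgebra.mem_centralizer_iff]
    rintro _ rfl
    exact hτP i a
  let T : I → A → Subalgebra.centralizer F {P} := fun i a => ⟨τ i a, hτmem i a⟩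
  have hT1 : ∀ i, T i 1 = 1 := fun i => Subtype.ext (psi_one _ _)
  have hTm : ∀ i a b, T i (a * b) = T i a * T i b := fun i a b =>
    Subtype.ext (psi_mul (fun k => g (i, k)) (hci i) (fun _ => a) (fun _ => b))
  have hTa : ∀ i a b, ρ (T i (a + b)) = ρ (T i a) + ρ (T i b) := by
    intro i a b
    have := hρ (T i (a + b) - T i a - T i b) (fun w hw =>
      tau_add p P (fun k => g (i, k)) (hci i) (fun k a => hPg (i, k) a) a b w hw)
    rw [map_sub, map_sub, sub_sub, sub_eq_zero] at this
    exact this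
  have hTc : ∀ i c, T i (algebraMap K A c) = algebraMap F _ ((φ c) ^ p) := by
    intro i c
    apply Subtype.ext
    change psi (fun k => g (i, k)) (hci i) (fun _ => algebraMap K A c) = _
    have h3 : (fun _ : ZMod p => algebraMap K A c) = fun k => c • (1 : ZMod p → A) k := by
      ext1 k
      rw [Pi.one_apply, Algebra.algebraMap_eq_smul_one]
    rw [h3, MultilinearMap.map_smul_univ, psi_one]
    simp [ZMod.card]
    rw [← Algebra.algebraMap_eq_smul_one, map_pow]
    rfl
  refine ⟨fun i => 
    { toFun := fun a => ρ (T i a)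
      map_one' := by rw [hT1, map_one]
      map_mul' := fun a b => by rw [hTm, map_mul]
      map_zero' := by
        have := hTa i 0 0
        simpa using this
      map_add' := hTa i }, ?_, ?_⟩
  · intro i c
    change ρ (T i (algebraMap K A c)) = _
    rw [hTc, AlgHom.commutes]
    rfl
  · intro i j hij x y
    change Commute (ρ (T i x)) (ρ (T j y))
    refine Commute.map ?_ ρ
    apply Subtype.ext
    change τ i x * τ j y = τ j y * τ i x
    refine psi_commute (fun k => g (j, k)) (hci j) (τ i x) (fun k a => ?_) _
    refine (psi_commute (fun k => g (i, k)) (hci i) (g (j, k) a) (fun l b => ?_) _).symm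
    exact h2 (fun h => hij (congrArg Prod.fst h).symm) _ _

theorem morita_dvd {K D V : Type} [Field K] [DivisionRing D] [Algebra K D] [AddCommGroup V]
    [Module K V] [FiniteDimensional K V] {r : ℕ} (hr : 0 < r)
    (θ : Matrix (Fin r) (Fin r) D →ₐ[K] Module.End K V) :
    r * Module.finrank K D ∣ Module.finrank K V := by
  let i0 : Fin r := ⟨0, hr⟩
  let W : Submodule K V := LinearMap.range (θ (Matrix.single i0 i0 1))
  have hθ : ∀ (i j k : Fin r) (a b : D) (v : V), θ (Matrix.single i j a) (θ (Matrix.single j k b) v) =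
      θ (Matrix.single i k (a * b)) v := by
    intro i j k a b v
    rw [← Module.End.mul_apply, ← map_mul, Matrix.single_mul_single_same]
  have hW : ∀ w : V, w ∈ W ↔ θ (Matrix.single i0 i0 1) w = w := by
    intro w
    constructor
    · rintro ⟨v, rfl⟩
      rw [hθ, mul_one]
    · intro h
      exact ⟨w, h⟩
  have hmem : ∀ (j : Fin r) (a : D) (v : V), θ (Matrix.single i0 j a) v ∈ W := by
    intro j a v
    rw [hW, hθ, one_mul]
  let eq : V ≃ₗ[K] (Fin r → W) :=
    { toFun := fun v i => ⟨θ (Matrix.single i0 i 1) v, hmem _ _ _⟩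
      map_add' := by intro v v'; ext i; simp
      map_smul' := by intro c v; ext i; simp
      invFun := fun u => ∑ i, θ (Matrix.single i i0 1) (u i)
      left_inv := by
        intro v
        simp only [hθ, mul_one]
        rw [← LinearMap.sum_apply, ← map_sum, Matrix.sum_single_one, map_one]
        rfl
      right_inv := by
        intro u
        ext i
        simp only [map_sum]
        rw [Finset.sum_eq_single i]
        · rw [hθ, mul_one]; exact (hW _).1 (u i).2
        · intro j _ hj
          rw [← Module.End.mul_apply, ← map_mul, Matrix.single_mul_single_of_ne]
          · simp
          · exact hj.symm
        · simp }
  letI : SMul D W := ⟨fun c w => ⟨θ (Matrix.single i0 i0 c) w, hmem _ _ _⟩⟩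
  have hsm : ∀ (c : D) (w : W), ((c • w : W) : V) = θ (Matrix.single i0 i0 c) w := fun _ _ => rfl
  letI : Module D W := Module.ofMinimalAxioms
    (by intro c w w'; ext; simp [hsm])
    (by intro c c' w; ext; simp [hsm, Matrix.single_add])
    (by intro c c' w; ext; simp [hsm, hθ])
    (by intro w; ext; exact (hW _).1 w.2)
  have : IsScalarTower K D W := by
    constructor
    intro k c w
    ext
    simp only [hsm, Submodule.coe_smul]
    rw [← Matrix.smul_single, map_smul]
    rfl
  have h1 : Module.finrank K V = r * Module.finrank K W := by
    rw [eq.finrank_eq, Module.finrank_pi_fintype]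
    simp
  rw [h1, ← Module.finrank_mul_finrank K D W, ← mul_assoc]
  exact Dvd.intro _ rfl

/-- The degree of a field homomorphism. -/
def homDeg {K F : Type} [Field K] [Field F] (φ : K →+* F) : ℕ :=
  @Module.finrank K F _ _ φ.toAlgebra.toModule

theorem homDeg_id {K : Type} [Field K] : homDeg (RingHom.id K) = 1 := Module.finrank_self K

theorem homDeg_comp {K F E : Type} [Field K] [Field F] [Field E] (φ : K →+* F) (ψ : F →+* E) :
    homDeg (ψ.comp φ) = homDeg φ * homDeg ψ := by
  letI := φ.toAlgebra
  letI := ψ.toAlgebra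
  letI := (ψ.comp φ).toAlgebra
  haveI : IsScalarTower K F E := IsScalarTower.of_algebraMap_eq fun _ => rfl
  exact (Module.finrank_mul_finrank K F E).symm

theorem homDeg_pow {K : Type} [Field K] (φ : K →+* K) (m : ℕ) :
    homDeg (φ ^ m) = homDeg φ ^ m := by
  induction m with
  | zero => exact homDeg_id
  | succ m ih =>
    rw [pow_succ, pow_succ, ← ih, mul_comm]
    exact homDeg_comp φ (φ ^ m)

theorem final_dvd {K F A D : Type} [Field K] [Field F] [Ring A] [Algebra K A] [DivisionRing D]
    [Algebra K D] (φ : K →+* F) (hq : 0 < homDeg φ) {d r δ : ℕ} (hd : 0 < d) (hr : 0 < r)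
    (hdim : Module.finrank K A = d ^ 2) (hD : Module.finrank K D = δ ^ 2)
    (e : A ≃ₐ[K] Matrix (Fin r) (Fin r) D) {J : Type} (hJ : Nat.card J = 1)
    (h : HasFam φ A d J) : δ ∣ homDeg φ := by
  obtain ⟨κ, h1, -⟩ := h
  have hn : Nonempty J := (Nat.card_pos_iff.1 (by rw [hJ]; norm_num)).1
  obtain ⟨j⟩ := hn
  letI := φ.toAlgebra
  have hqq : homDeg φ = Module.finrank K F := rfl
  have hff : FiniteDimensional K F := Module.finite_of_finrank_pos hq
  let g : A →ₐ[K] Matrix (Fin (d ^ Nat.card J)) (Fin (d ^ Nat.card J)) F :=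
    { κ j with commutes' := fun c => h1 j c }
  let η : Matrix (Fin (d ^ Nat.card J)) (Fin (d ^ Nat.card J)) F →ₐ[K]
      Module.End K (Fin (d ^ Nat.card J) → F) :=
    { toFun := fun M => (Matrix.toLin' M).restrictScalars K
      map_one' := by ext; simp
      map_mul' := by intro a b; ext; simp
      map_zero' := by ext; simp
      map_add' := by intro a b; ext; simp
      commutes' := by
        intro c
        refine LinearMap.ext fun v => ?_
        change (algebraMap K (Matrix (Fin (d ^ Nat.card J)) (Fin (d ^ Nat.card J)) F) c).mulVec v = c • v
        rw [Algebra.algebraMap_eq_smul_one, Matrix.smul_mulVec, Matrix.one_mulVec] }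
  have h2 := morita_dvd hr ((η.comp g).comp e.symm.toAlgHom)
  have h3 : d = r * δ := by
    have h4 := e.toLinearEquiv.finrank_eq
    rw [hdim, Module.finrank_matrix, hD] at h4
    simp at h4
    apply Nat.pow_left_injective (n := 2) (by norm_num)
    simp only
    rw [h4]; ring
  rw [Module.finrank_pi_fintype, hD] at h2
  simp only [hJ, pow_one, Finset.sum_const, Finset.card_univ, Fintype.card_fin, smul_eq_mul] at h2
  rw [hqq]
  have h5 : 0 < r * δ := h3 ▸ hd
  have h6 : r * δ * δ ∣ r * δ * Module.finrank K F := by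
    rw [h3] at h2
    convert h2 using 1
    ring
  exact Nat.dvd_of_mul_dvd_mul_left h5 h6

theorem HasFam.iter {K F : Type} [Field K] [Field F] {A : Type} [Ring A]
    [Algebra K A] (hcen : Subalgebra.center K A = ⊥) [IsSimpleRing A] [FiniteDimensional K A]
    {d : ℕ} (hd : 0 < d) (hdim : Module.finrank K A = d ^ 2) (p : ℕ) [hp : Fact p.Prime]
    [CharP F p] (m : ℕ) : ∀ (φ : K →+* F), HasFam φ A d (Fin (p ^ m)) →
    HasFam (((frobenius F p) ^ m).comp φ) A d (Fin (p ^ 0)) := by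
  induction m with
  | zero => intro φ h; exact h
  | succ m ih =>
    intro φ h
    have e : Fin (p ^ m) × ZMod p ≃ Fin (p ^ (m + 1)) :=
      Fintype.equivOfCardEq (by simp [ZMod.card, pow_succ])
    have := ih _ (HasFam.step hcen hd hdim p (h.congr e))
    rw [pow_succ]
    exact this

theorem HasFam.base {K : Type} [Field K] {A : Type} [Ring A] [Algebra K A]
    [FiniteDimensional K A] {d : ℕ} (hdim : Module.finrank K A = d ^ 2) {n N : ℕ}
    (e : (⨂[K] _ : Fin n, A) ≃ₐ[K] Matrix (Fin N) (Fin N) K) :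
    HasFam (RingHom.id K) A d (Fin n) := by
  have hN : N = d ^ Nat.card (Fin n) := by
    have h4 := e.toLinearEquiv.finrank_eq
    rw [Module.finrank_matrix, Module.finrank_eq_card_basis
      (Basis.piTensorProduct fun _ : Fin n => Module.finBasis K A), Fintype.card_pi] at h4
    simp [hdim] at h4
    apply Nat.pow_left_injective (n := 2) (by norm_num)
    simp only [Nat.card_eq_fintype_card, Fintype.card_fin]
    rw [sq, ← h4, ← pow_mul, ← pow_mul, mul_comm]
  unfold HasFam
  rw [← hN]
  refine ⟨fun i => (e.toAlgHom.comp (PiTensorProduct.singleAlgHom (A := fun _ => A) i)).toRingHom, ?_, ?_⟩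
  · intro i c
    exact (e.toAlgHom.comp (PiTensorProduct.singleAlgHom (A := fun _ => A) i)).commutes c
  · intro i j hij x y
    refine Commute.map ?_ e.toAlgHom
    exact Commute.tprod (Pi.mulSingle_commute (f := fun _ : Fin n => A) hij x y)

theorem index_mem (K A : Type) [Field K] [Ring A] [Algebra K A] [IsSimpleRing A]
    [FiniteDimensional K A] {d : ℕ} (hd : 0 < d) (hdim : Module.finrank K A = d ^ 2) :
    ∃ δ : ℕ, ∃ (D : Type) (_ : DivisionRing D) (_ : Algebra K D) (r : ℕ), 0 < r ∧
    Nonempty (A ≃ₐ[K] Matrix (Fin r) (Fin r) D) ∧ Module.finrank K D = δ ^ 2 := by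
  have : IsArtinianRing A := IsArtinianRing.of_finite K A
  obtain ⟨r, hr, D, _, _, _, ⟨e⟩⟩ := IsSimpleRing.exists_algEquiv_matrix_divisionRing_finite K A
  have h4 := e.toLinearEquiv.finrank_eq
  rw [hdim, Module.finrank_matrix] at h4
  simp only [Fintype.card_fin] at h4
  have h5 : r ^ 2 ∣ d ^ 2 := ⟨Module.finrank K D, by rw [h4]; ring⟩
  have h6 : r ∣ d := (Nat.pow_dvd_pow_iff (by norm_num)).1 h5
  have hr0 : 0 < r := Nat.pos_of_ne_zero hr.out
  obtain ⟨δ, rfl⟩ := h6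
  refine ⟨δ, D, _, _, r, hr0, ⟨e⟩, ?_⟩
  apply Nat.eq_of_mul_eq_mul_left (show 0 < r * r by positivity)
  rw [← h4]; ring

theorem homDeg_frobenius (p : ℕ) [hp : Fact p.Prime] (K : Type) [Field K] [CharP K p] :
    homDeg (frobenius K p) = pDegree K p := by
  let i : K →+* pthPowers K p := (frobenius K p).codRestrict (pthPowers K p)
    (fun x => Subfield.subset_closure ⟨x, rfl⟩)
  have hi : Function.Bijective i := by
    refine ⟨i.injective, ?_⟩
    rintro ⟨x, hx⟩
    have h1 : pthPowers K p ≤ (frobenius K p).fieldRange := by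
      rw [pthPowers, Subfield.closure_le]
      rintro _ ⟨y, rfl⟩
      exact ⟨y, rfl⟩
    obtain ⟨y, hy⟩ := h1 hx
    exact ⟨y, Subtype.ext hy⟩
  letI := (frobenius K p).toAlgebra
  exact Algebra.finrank_eq_of_equiv_equiv (RingEquiv.ofBijective i hi) (RingEquiv.refl K) rfl

/-- Let `K` be a field of characteristic `p > 0` with `[K:K^p] = p^n`.
Then `Br.dim_p(K) ≤ n`: every central simple `K`-algebra `A` whose period is a power of
`p` satisfies `ind(A) ∣ per(A)^n`. -/
theorem brauer_p_dim_le_p_rank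
    (p : ℕ) [Fact p.Prime]
    (K : Type) [Field K] [CharP K p]
    (n : ℕ) (hK : pDegree K p = p ^ n)
    (A : Type) [Ring A] [Algebra K A] (hA : IsCSA K A)
    (hper : ∃ m : ℕ, period K A = p ^ m) :
    index K A ∣ period K A ^ n := by
  obtain ⟨hcen, hsimp, hfin⟩ := hA
  obtain ⟨m, hm⟩ := hper
  have hp : p.Prime := Fact.out
  obtain ⟨d, hd, hdim, -⟩ := csa_split_sepClosed K A (SeparableClosure K) hcen
  have hpos : 0 < period K A := by rw [hm]; exact pow_pos hp.pos m
  obtain ⟨-, N, -, ⟨e⟩⟩ := Nat.sInf_mem (Nat.nonempty_of_pos_sInf hpos)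
  have hfam : HasFam (RingHom.id K) A d (Fin (period K A)) := HasFam.base hdim e
  rw [hm] at hfam
  have hfam2 := HasFam.iter hcen hd hdim p m _ hfam
  have hdeg : homDeg (((frobenius K p) ^ m).comp (RingHom.id K)) = (p ^ n) ^ m := by
    rw [RingHom.comp_id, homDeg_pow, homDeg_frobenius, hK]
  obtain ⟨D, _, _, r, hr, ⟨e'⟩, hD⟩ := Nat.sInf_mem (index_mem K A hd hdim)
  have := final_dvd _ (by rw [hdeg]; exact pow_pos (pow_pos hp.pos n) m) hd hr hdim hD e'
    (by simp) hfam2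
  rw [hdeg] at this
  rw [hm, ← pow_mul, mul_comm, pow_mul]
  exact this
end
end

section
/- Let k be a field of characteristic p > 0 with [k:k^p] = p. Then every finite field extension k'/k is simple: there exists α ∈ k' such that k' = k(α). -/
open scoped TensorProduct

noncomputable section

lemma pthPowers_mem_iff (K : Type) [Field K] (p : ℕ) [Fact p.Prime] [CharP K p] (x : K) :
    x ∈ pthPowers K p ↔ ∃ y, y ^ p = x := by
  have : pthPowers K p = (frobenius K p).fieldRange := by
    unfold pthPowers
    have h : (Set.range fun x : K => x ^ p) = ((frobenius K p).fieldRange : Set K) := by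
      ext x; simp [frobenius_def]
    rw [h, Subfield.closure_eq]
  rw [this]
  simp [frobenius_def]

/-- The isomorphism `K ≃ K^p`. -/
def frobEquiv (K : Type) [Field K] (p : ℕ) [Fact p.Prime] [CharP K p] :
    K ≃+* pthPowers K p :=
  RingEquiv.ofBijective
    ((frobenius K p).codRestrict (pthPowers K p) fun x =>
      (pthPowers_mem_iff K p _).2 ⟨x, rfl⟩) <| by
    constructor
    · exact RingHom.injective _
    · rintro ⟨x, hx⟩
      obtain ⟨y, rfl⟩ := (pthPowers_mem_iff K p x).1 hx
      exact ⟨y, rfl⟩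

lemma coe_frobEquiv (K : Type) [Field K] (p : ℕ) [Fact p.Prime] [CharP K p] (x : K) :
    (frobEquiv K p x : K) = x ^ p := rfl

lemma pDegree_eq_of_finite (p : ℕ) [Fact p.Prime]
    (k : Type) [Field k] [CharP k p]
    (K : Type) [Field K] [CharP K p] [Algebra k K] [FiniteDimensional k K] :
    pDegree K p = pDegree k p := by
  let f : pthPowers k p →+* pthPowers K p :=
    ((algebraMap k K).comp (pthPowers k p).subtype).codRestrict (pthPowers K p) (by
      rintro ⟨x, hx⟩
      obtain ⟨y, rfl⟩ := (pthPowers_mem_iff k p x).1 hx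
      exact (pthPowers_mem_iff K p _).2 ⟨algebraMap k K y, by simp⟩)
  let : Algebra (pthPowers k p) (pthPowers K p) := f.toAlgebra
  have : IsScalarTower (pthPowers k p) (pthPowers K p) K :=
    IsScalarTower.of_algebraMap_eq fun x => rfl
  have h1 := Module.finrank_mul_finrank (pthPowers k p) k K
  have h2 := Module.finrank_mul_finrank (pthPowers k p) (pthPowers K p) K
  have h3 : Module.finrank k K = Module.finrank (pthPowers k p) (pthPowers K p) := by
    apply Algebra.finrank_eq_of_equiv_equiv (frobEquiv k p) (frobEquiv K p)
    ext x
    change algebraMap k K (x ^ p) = (algebraMap k K x) ^ p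
    simp
  rw [← h3, ← h1, mul_comm] at h2
  exact Nat.eq_of_mul_eq_mul_right Module.finrank_pos h2

/-- If `K = F(K^p)` and `K^(p^n) ⊆ F` then `F = K`. -/
lemma eq_top_of_frob {k K : Type} [Field k] [Field K] [Algebra k K] (p : ℕ) [Fact p.Prime]
    [CharP K p] (F : IntermediateField k K)
    (h : ∀ N : IntermediateField k K, F ≤ N → (∀ x : K, x ^ p ∈ N) → N = ⊤)
    (n : ℕ) (hn : ∀ x : K, x ^ p ^ n ∈ F) : F = ⊤ := by
  have key : ∀ n, ∀ N : IntermediateField k K, F ≤ N → (∀ x : K, x ^ p ^ n ∈ N) → N = ⊤ := by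
    intro n
    induction n with
    | zero =>
      intro N _ hN
      rw [eq_top_iff]
      intro x _
      simpa using hN x
    | succ n ih =>
      intro N hF hN
      refine ih N hF ?_
      let N' : IntermediateField k K :=
        { (N.toSubfield.comap (iterateFrobenius K p n)) with
          algebraMap_mem' := fun c => by
            change (algebraMap k K c) ^ p ^ n ∈ N
            exact pow_mem (N.algebraMap_mem c) _ }
      have hN' : N' = ⊤ := by
        refine h N' (fun x hx => ?_) (fun x => ?_)
        · change x ^ p ^ n ∈ N
          exact pow_mem (hF hx) _
        · change (x ^ p) ^ p ^ n ∈ N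
          rw [← pow_mul, ← pow_succ']
          exact hN x
      intro x
      have : x ∈ N' := hN' ▸ IntermediateField.mem_top
      exact this
  exact key n F le_rfl hn

/-- Let `k` be a field of characteristic `p > 0` with `[k:k^p] = p`.
Then every finite field extension `k'/k` is simple: there is `α ∈ k'` with
`k' = k(α)`. -/
theorem finite_extension_is_simple
    (p : ℕ) [Fact p.Prime]
    (k : Type) [Field k] [CharP k p] (hk : pDegree k p = p)
    (k' : Type) [Field k'] [Algebra k k'] [FiniteDimensional k k'] :
    ∃ α : k', IntermediateField.adjoin k {α} = ⊤ := by
  have : CharP k' p := charP_of_injective_algebraMap (algebraMap k k').injective p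
  have hK : pDegree k' p = p := (pDegree_eq_of_finite p k k').trans hk
  rcases finite_or_infinite k with hfin | hinf
  · exact Field.exists_primitive_element_of_finite_bot k k'
  let S := separableClosure k k'
  obtain ⟨n, hn⟩ : ∃ n, ∀ x : k', x ^ p ^ n ∈ S := by
    obtain ⟨n, hn⟩ := (IsPurelyInseparable.hasExponent_iff' (K := S) (L := k') p).1 inferInstance
    refine ⟨n, fun x => ?_⟩
    obtain ⟨y, hy⟩ := hn x
    rw [← hy]
    exact y.2
  have : Finite (IntermediateField k S) :=
    Field.finite_intermediateField_of_exists_primitive_element k S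
      (Field.exists_primitive_element k S)
  let M : IntermediateField k k' := IntermediateField.adjoin k (Set.range fun x : k' => x ^ p)
  let W : IntermediateField k S → Submodule k k' := fun T =>
    { carrier := {x | (⟨x ^ p ^ n, hn x⟩ : S) ∈ T}
      zero_mem' := by
        have : (⟨(0 : k') ^ p ^ n, hn 0⟩ : S) = 0 := by
          ext; simp [(Fact.out : p.Prime).ne_zero]
        simp only [Set.mem_ofPred_eq, this, zero_mem]
      add_mem' := by
        intro a b ha hb
        have : (⟨(a + b) ^ p ^ n, hn _⟩ : S) = ⟨a ^ p ^ n, hn a⟩ + ⟨b ^ p ^ n, hn b⟩ := by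
          ext; simp [add_pow_char_pow]
        simp only [Set.mem_ofPred_eq, this]
        exact add_mem ha hb
      smul_mem' := by
        intro c a ha
        have : (⟨(c • a) ^ p ^ n, hn _⟩ : S) = (c ^ p ^ n) • ⟨a ^ p ^ n, hn a⟩ := by
          ext; simp [smul_pow]
        simp only [Set.mem_ofPred_eq, this]
        exact T.smul_mem ha }
  have hW : ∀ T, W T = ⊤ → T = ⊤ := by
    intro T hT
    rw [eq_top_iff]
    intro s _
    have h1 : (s : k') ∈ W T := hT ▸ Submodule.mem_top
    have h2 : s ^ p ^ n ∈ T := h1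
    have h3 := IntermediateField.adjoin_simple_eq_adjoin_pow_expChar_pow_of_isSeparable' k S s p n
    have h4 : s ∈ IntermediateField.adjoin k {s} := IntermediateField.mem_adjoin_simple_self k s
    rw [h3] at h4
    exact (IntermediateField.adjoin_simple_le_iff.2 h2) h4
  let s : Set (Submodule k k') := {V | V ≠ ⊤ ∧ (V ∈ Set.range W ∨ V = M.toSubmodule)}
  have hs : s.Finite := by
    refine ((Set.finite_range W).union (Set.finite_singleton (Subalgebra.toSubmodule M.toSubalgebra))).subset ?_
    rintro V ⟨_, h⟩
    exact h
  obtain ⟨γ, hγ⟩ : ∃ γ : k', ∀ V ∈ s, γ ∉ V := by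
    by_contra! hcon
    have h1 : ⊤ ∈ hs.toFinset := by
      apply Subspace.top_mem_of_biUnion_eq_univ
      rw [Set.eq_univ_iff_forall]
      intro x
      obtain ⟨V, hV, hx⟩ := hcon x
      simp only [Set.mem_iUnion]
      exact ⟨V, hs.mem_toFinset.2 hV, hx⟩
    exact (hs.mem_toFinset.1 h1).1 rfl
  refine ⟨γ, ?_⟩
  have hS : S ≤ IntermediateField.adjoin k {γ} := by
    let T := IntermediateField.adjoin k {(⟨γ ^ p ^ n, hn γ⟩ : S)}
    have hT : T = ⊤ := by
      by_contra hne
      exact hγ (W T) ⟨fun h => hne (hW T h), Or.inl ⟨T, rfl⟩⟩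
        (IntermediateField.mem_adjoin_simple_self k _)
    intro x hx
    have h1 : (⟨x, hx⟩ : S) ∈ T := hT ▸ IntermediateField.mem_top
    have h2 : T ≤ (IntermediateField.adjoin k {γ}).comap S.val := by
      refine IntermediateField.adjoin_simple_le_iff.2 ?_
      change γ ^ p ^ n ∈ IntermediateField.adjoin k {γ}
      exact pow_mem (IntermediateField.mem_adjoin_simple_self k _) _
    exact h2 h1
  refine eq_top_of_frob p _ ?_ n fun x => hS (hn x)
  intro N hN hNp
  have hMN : M ≤ N := by
    rw [IntermediateField.adjoin_le_iff]
    rintro _ ⟨x, rfl⟩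
    exact hNp x
  by_cases hM : M = ⊤
  · rw [eq_top_iff, ← hM]; exact hMN
  have hγM : γ ∉ M := fun h => hγ M.toSubmodule ⟨fun h => hM (IntermediateField.toSubalgebra_injective (by simpa using h)), Or.inr rfl⟩ h
  have hprime : (Module.finrank (pthPowers k' p) k').Prime := by
    change (pDegree k' p).Prime
    rw [hK]; exact Fact.out
  have := IntermediateField.isSimpleOrder_of_finrank_prime (pthPowers k' p) k' hprime
  let conv : (L : IntermediateField k k') → (∀ x : k', x ^ p ∈ L) →
      IntermediateField (pthPowers k' p) k' := fun L hL =>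
    { L.toSubfield with
      algebraMap_mem' := by
        rintro ⟨x, hx⟩
        obtain ⟨y, rfl⟩ := (pthPowers_mem_iff k' p x).1 hx
        exact hL y }
  rcases eq_bot_or_eq_top (conv N hNp) with h | h
  · exfalso
    apply hγM
    have h1 : γ ∈ conv N hNp := hN (IntermediateField.mem_adjoin_simple_self k _)
    rw [h] at h1
    have hMp : ∀ x : k', x ^ p ∈ M := fun x => IntermediateField.subset_adjoin _ _ ⟨x, rfl⟩
    have h2 : γ ∈ conv M hMp := (bot_le : ⊥ ≤ conv M hMp) h1
    exact h2
  · rw [eq_top_iff]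
    intro x _
    have h1 : x ∈ conv N hNp := h ▸ IntermediateField.mem_top
    exact h1
end
end

section
/- Let F be a field, p a prime, and m ≥ 1 an integer. Suppose that for every finite field extension E/F, every central simple E-algebra of period p has index dividing p^m. Then for every n ≥ 1, every central simple F-algebra of period p^n has index dividing p^{mn}. -/
open scoped TensorProduct

noncomputable section

/-- Density for a homomorphism into an endomorphism algebra. -/
lemma density_hom {K R V : Type} [Field K] [Ring R] [Algebra K R] [AddCommGroup V] [Module K V]
    [FiniteDimensional K V] [Nontrivial V] (φ : R →ₐ[K] Module.End K V)
    (hs : ∀ W : Submodule K V, (∀ r, ∀ w ∈ W, φ r w ∈ W) → W = ⊥ ∨ W = ⊤)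
    (f : Module.End K V)
    (hf : ∀ g : Module.End K V, (∀ r, Commute g (φ r)) → Commute g f) :
    ∃ r, φ r = f := by
  let _ : Module R V := Module.compHom V φ.toRingHom
  have hsm : ∀ (r : R) (v : V), r • v = φ r v := fun _ _ => rfl
  have : IsScalarTower K R V := ⟨fun k r v => by simp [hsm]⟩
  have : IsSimpleModule R V := by
    rw [isSimpleModule_iff]
    refine { toNontrivial := ?_, eq_bot_or_eq_top := ?_ }
    · infer_instance
    · intro W
      rcases hs (W.restrictScalars K) (fun r w hw => W.smul_mem r hw) with h | h
      · left; rwa [Submodule.restrictScalars_eq_bot_iff] at h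
      · right; rwa [Submodule.restrictScalars_eq_top_iff] at h
  let f' : Module.End (Module.End R V) V :=
    { toFun := f
      map_add' := f.map_add
      map_smul' := fun g v => by
        have := hf (g.restrictScalars K) (fun r => by
          ext v
          exact g.map_smul r v)
        exact (LinearMap.congr_fun this v).symm }
  classical
  let b := Module.finBasis K V
  obtain ⟨r, hr⟩ := jacobson_density f' (Finset.univ.image b)
  refine ⟨r, b.ext fun i => ?_⟩
  exact (hr (b i) (by simp)).symm

lemma mulLeftRight_surj (K A : Type) [Field K] [Ring A] [Algebra K A] [Algebra.IsCentral K A]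
    [IsSimpleRing A] [FiniteDimensional K A] :
    Function.Surjective (AlgHom.mulLeftRight K A) := by
  intro f
  refine density_hom _ ?_ f ?_
  · intro W hW
    have h1 : ∀ a b w, w ∈ W → a * w * b ∈ W := fun a b w hw => by
      simpa using hW (a ⊗ₜ MulOpposite.op b) w hw
    let I : TwoSidedIdeal A := TwoSidedIdeal.mk' (W : Set A) W.zero_mem (W.add_mem) (W.neg_mem)
      (fun {x y} hy => by simpa using h1 x 1 y hy) (fun {x y} hy => by simpa using h1 1 y x hy)
    have hI : ∀ x, x ∈ I ↔ x ∈ W := fun x => by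
      simp [I]
    rcases eq_bot_or_eq_top I with h | h
    · left
      rw [eq_bot_iff]
      intro x hx
      rw [← hI, h] at hx
      simpa using hx
    · right
      rw [eq_top_iff]
      intro x _
      rw [← hI, h]
      trivial
  · intro g hg
    have h1 : ∀ a x b, g (a * x * b) = a * g x * b := fun a x b => by
      simpa using LinearMap.congr_fun (hg (a ⊗ₜ MulOpposite.op b)) x
    have hc : g 1 ∈ Subalgebra.center K A := by
      rw [Subalgebra.mem_center_iff]
      intro b
      have e1 := h1 b 1 1
      have e2 := h1 1 1 b
      simp at e1 e2
      rw [← e1, ← e2]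
    obtain ⟨k, hk⟩ := (Algebra.IsCentral.mem_center_iff K).1 hc
    have hg' : ∀ x, g x = k • x := fun x => by
      have := h1 1 1 x
      simp [hk] at this
      rw [this, Algebra.smul_def]
    ext x
    simp [hg']

section tens
variable (K C A : Type) [Field K] [Ring C] [Algebra K C] [Ring A] [Algebra K A]

/-- contraction of the right factor by a functional -/
def contr (l : A →ₗ[K] K) : C ⊗[K] A →ₗ[K] C :=
  (TensorProduct.rid K C).toLinearMap ∘ₗ LinearMap.lTensor C l

@[simp] lemma contr_tmul (l : A →ₗ[K] K) (c : C) (a : A) :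
    contr K C A l (c ⊗ₜ a) = l a • c := by simp [contr]

lemma contr_expand [FiniteDimensional K A] (z : C ⊗[K] A) :
    z = ∑ i, contr K C A ((Module.finBasis K A).coord i) z ⊗ₜ Module.finBasis K A i := by
  induction z with
  | zero => simp
  | add x y hx hy =>
    conv_lhs => rw [hx, hy]
    simp [TensorProduct.add_tmul, Finset.sum_add_distrib]
  | tmul c a =>
    conv_lhs => rw [← (Module.finBasis K A).sum_repr a, TensorProduct.tmul_sum]
    simp [TensorProduct.smul_tmul]

lemma exists_contr_ne [FiniteDimensional K A] (z : C ⊗[K] A) (hz : z ≠ 0) :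
    ∃ l, contr K C A l z ≠ 0 := by
  by_contra! h
  exact hz (by rw [contr_expand K C A z]; simp [h])

/-- two-sided multiplications of the right factor -/
lemma lTensor_mulLeftRight (a b : A) (z : C ⊗[K] A) :
    LinearMap.lTensor C (AlgHom.mulLeftRight K A (a ⊗ₜ MulOpposite.op b)) z =
      (1 ⊗ₜ a) * z * (1 ⊗ₜ b) := by
  induction z with
  | zero => simp
  | add x y hx hy => simp [hx, hy, mul_add, add_mul]
  | tmul c a => simp

lemma contr_tmul_one (l : A →ₗ[K] K) (z : C ⊗[K] A) :
    contr K C A l z ⊗ₜ[K] (1 : A) =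
      LinearMap.lTensor C ((Algebra.linearMap K A) ∘ₗ l) z := by
  induction z with
  | zero => simp
  | add x y hx hy => simp [TensorProduct.add_tmul, hx, hy]
  | tmul c a =>
    simp [TensorProduct.smul_tmul, Algebra.algebraMap_eq_smul_one]

variable [Algebra.IsCentral K A] [IsSimpleRing A] [FiniteDimensional K A]

lemma contr_mem (I : TwoSidedIdeal (C ⊗[K] A)) (l : A →ₗ[K] K) (z : C ⊗[K] A) (hz : z ∈ I) :
    contr K C A l z ⊗ₜ[K] (1 : A) ∈ I := by
  rw [contr_tmul_one]
  obtain ⟨t, ht⟩ := mulLeftRight_surj K A ((Algebra.linearMap K A) ∘ₗ l)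
  rw [← ht]
  clear ht
  induction t with
  | zero => simp [I.zero_mem]
  | add x y hx hy =>
    rw [map_add, LinearMap.lTensor_add]
    exact I.add_mem hx hy
  | tmul a b =>
    obtain ⟨b, rfl⟩ := MulOpposite.op_surjective b
    rw [lTensor_mulLeftRight]
    exact I.mul_mem_right _ _ (I.mul_mem_left _ _ hz)

lemma contr_center (l : A →ₗ[K] K) (z : C ⊗[K] A) (hz : ∀ w, w * z = z * w) :
    contr K C A l z ⊗ₜ[K] (1 : A) = l 1 • z := by
  rw [contr_tmul_one]
  obtain ⟨t, ht⟩ := mulLeftRight_surj K A ((Algebra.linearMap K A) ∘ₗ l)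
  have h1 : (1 : C) ⊗ₜ[K] ((AlgHom.mulLeftRight K A t) 1) * z = l 1 • z := by
    rw [ht]
    simp [Algebra.algebraMap_eq_smul_one, ← Algebra.TensorProduct.one_def]
  rw [← ht, ← h1]
  clear ht h1
  induction t with
  | zero => simp
  | add x y hx hy =>
    rw [map_add, LinearMap.lTensor_add]
    simp [hx, hy, TensorProduct.tmul_add, add_mul]
  | tmul a b =>
    obtain ⟨b, rfl⟩ := MulOpposite.op_surjective b
    rw [lTensor_mulLeftRight, mul_assoc, ← hz, ← mul_assoc]
    simp

theorem tensor_simple [IsSimpleRing C] : IsSimpleRing (C ⊗[K] A) := by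
  have hinj : Function.Injective (Algebra.TensorProduct.includeLeft : C →ₐ[K] C ⊗[K] A) :=
    Algebra.TensorProduct.includeLeft_injective (FaithfulSMul.algebraMap_injective K A)
  have : Nontrivial (C ⊗[K] A) := hinj.nontrivial
  refine ⟨⟨fun I => ?_⟩⟩
  by_cases hI : I = ⊥
  · exact Or.inl hI
  right
  obtain ⟨z, hz, hz0⟩ : ∃ z ∈ I, z ≠ 0 := by
    by_contra! h
    apply hI
    rw [eq_bot_iff]
    intro x hx
    simpa using h x hx
  obtain ⟨l, hl⟩ := exists_contr_ne K C A z hz0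
  have hm := contr_mem K C A I l z hz
  let J : TwoSidedIdeal C :=
    I.comap (Algebra.TensorProduct.includeLeft : C →ₐ[K] C ⊗[K] A)
  have hJ : contr K C A l z ∈ J := by
    rw [TwoSidedIdeal.mem_comap]; exact hm
  rcases eq_bot_or_eq_top J with h | h
  · rw [h] at hJ; exact absurd (by simpa using hJ) hl
  · have h1 : (1 : C) ∈ J := by rw [h]; trivial
    rw [TwoSidedIdeal.mem_comap] at h1
    rw [map_one] at h1
    exact I.one_mem_iff.1 h1

lemma tensor_center (z : C ⊗[K] A) (hz : ∀ w, w * z = z * w) :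
    ∃ c : C, (∀ d, d * c = c * d) ∧ z = c ⊗ₜ 1 := by
  have hinj : Function.Injective (Algebra.TensorProduct.includeLeft : C →ₐ[K] C ⊗[K] A) :=
    Algebra.TensorProduct.includeLeft_injective (FaithfulSMul.algebraMap_injective K A)
  obtain ⟨l, hl⟩ := Module.Projective.exists_dual_eq_one K (one_ne_zero (α := A))
  have h := contr_center K C A l z hz
  rw [hl, one_smul] at h
  refine ⟨_, fun d => ?_, h.symm⟩
  apply hinj
  rw [map_mul, map_mul]
  have := hz (d ⊗ₜ 1)
  rw [← h] at this
  exact this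

theorem tensor_central [Algebra.IsCentral K C] : Algebra.IsCentral K (C ⊗[K] A) := by
  refine ⟨fun z hz => ?_⟩
  rw [Subalgebra.mem_center_iff] at hz
  obtain ⟨c, hc, rfl⟩ := tensor_center K C A z hz
  obtain ⟨k, rfl⟩ := (Algebra.IsCentral.mem_center_iff K).1 (Subalgebra.mem_center_iff.2 hc)
  exact ⟨k, by simp [Algebra.TensorProduct.algebraMap_apply]⟩

theorem baseChange_central (L : Type) [Field L] [Algebra K L] :
    Algebra.IsCentral L (L ⊗[K] A) := by
  refine ⟨fun z hz => ?_⟩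
  rw [Subalgebra.mem_center_iff] at hz
  obtain ⟨c, hc, rfl⟩ := tensor_center K L A z hz
  exact ⟨c, by simp [Algebra.TensorProduct.algebraMap_apply]⟩
end tens

lemma matrix_module_dvd {K D V : Type} [Field K] [DivisionRing D] [Algebra K D]
    [AddCommGroup V] [Module K V] [FiniteDimensional K V] {r : ℕ} (hr : 0 < r)
    (φ : Matrix (Fin r) (Fin r) D →ₐ[K] Module.End K V) :
    r * Module.finrank K D ∣ Module.finrank K V := by
  let j : Fin r := ⟨0, hr⟩
  let _ : Module (Matrix (Fin r) (Fin r) D) V := Module.compHom V φ.toRingHom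
  have hsm : ∀ (x : Matrix (Fin r) (Fin r) D) (v : V), x • v = φ x v := fun _ _ => rfl
  let _ : Module D V := Module.compHom V (Matrix.scalar (α := D) (Fin r))
  have hsm' : ∀ (x : D) (v : V), x • v = φ (Matrix.scalar (Fin r) x) v := fun _ _ => rfl
  have : IsScalarTower K D V := ⟨fun k d v => by
    rw [hsm', hsm', ← LinearMap.smul_apply, ← map_smul]
    congr 2
    ext a b
    simp [Matrix.diagonal_apply]⟩
  have ht := MatrixModCat.isScalarTower_toModuleCat D
    (ModuleCat.of (Matrix (Fin r) (Fin r) D) V)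
  let W : Submodule D V := MatrixModCat.toModuleCatObj D
    (ModuleCat.of (Matrix (Fin r) (Fin r) D) V) j
  have e := toModuleCatFromModuleCatLinearEquiv (R := D)
    (ModuleCat.of (Matrix (Fin r) (Fin r) D) V) j
  have hW : ∀ (k : K) (v : V), k • v = (algebraMap K D k) • v := fun k v => by
    rw [algebraMap_smul]
  have hK : ∀ (k : K) (v : V),
      k • v = (algebraMap K (Matrix (Fin r) (Fin r) D) k) • v := fun k v => by
    rw [hsm]; simp
  let e' : V ≃ₗ[K] (Fin r → W) :=
    { e with
      map_smul' := fun k v => by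
        change e (k • v) = k • e v
        rw [hK, e.map_smul]
        funext i
        rw [Matrix.Module.smul_apply, Finset.sum_eq_single i]
        · rw [Matrix.algebraMap_matrix_apply, if_pos rfl]
          apply Subtype.ext
          exact (hW k _).symm
        · intro b _ hb
          rw [Matrix.algebraMap_matrix_apply, if_neg hb.symm, zero_smul]
        · simp }
  have : Module.Finite K W := Module.Finite.of_surjective
    ((LinearMap.proj j : (Fin r → W) →ₗ[K] W) ∘ₗ e'.toLinearMap)
    ((Function.surjective_eval j).comp e'.surjective)
  rw [e'.finrank_eq, Module.finrank_pi_fintype]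
  simp only [Finset.sum_const, Finset.card_univ, Fintype.card_fin, smul_eq_mul]
  rw [← Module.finrank_mul_finrank K D W]
  exact mul_dvd_mul_left r (dvd_mul_right _ _)

theorem split_deg {K L A D : Type} [Field K] [Field L] [Algebra K L] [FiniteDimensional K L]
    [Ring A] [Algebra K A] [DivisionRing D] [Algebra K D] {r s : ℕ} (hr : 0 < r) (hs : 0 < s)
    (e : A ≃ₐ[K] Matrix (Fin r) (Fin r) D)
    (e' : L ⊗[K] A ≃ₐ[L] Matrix (Fin s) (Fin s) L) :
    ∃ d, Module.finrank K D = d ^ 2 ∧ d ∣ Module.finrank K L := by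
  have h1 : Module.finrank K A = r ^ 2 * Module.finrank K D := by
    rw [e.toLinearEquiv.finrank_eq, Module.finrank_matrix, Fintype.card_fin, sq]
  have h2 : Module.finrank K A = s ^ 2 := by
    rw [← Module.finrank_baseChange (R := L), e'.toLinearEquiv.finrank_eq, Module.finrank_matrix, Fintype.card_fin,
      Module.finrank_self, mul_one, sq]
  have h3 : r ∣ s := by
    rw [← Nat.pow_dvd_pow_iff (n := 2) (by norm_num), ← h2, h1]
    exact dvd_mul_right _ _
  obtain ⟨d, rfl⟩ := h3
  have h4 : Module.finrank K D = d ^ 2 := by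
    rw [h2, mul_pow] at h1
    exact (Nat.eq_of_mul_eq_mul_left (by positivity) h1).symm
  refine ⟨d, h4, ?_⟩
  let f1 : Matrix (Fin (r * d)) (Fin (r * d)) L →ₐ[K] Module.End K (Fin (r * d) → L) :=
    AlgHom.ofLinearMap
      { toFun := fun M => (Matrix.toLin' M).restrictScalars K
        map_add' := fun x y => by ext; simp
        map_smul' := fun k x => by ext; simp [mul_comm] }
      (by ext; simp) (fun x y => by ext; simp)
  have h5 := matrix_module_dvd hr
    ((f1.comp ((e'.restrictScalars K).toAlgHom.comp
      (Algebra.TensorProduct.includeRight : A →ₐ[K] L ⊗[K] A))).comp e.symm.toAlgHom)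
  rw [h4, Module.finrank_pi_fintype] at h5
  simp only [Finset.sum_const, Finset.card_univ, Fintype.card_fin, smul_eq_mul] at h5
  have hd : 0 < d := Nat.pos_of_mul_pos_left hs
  rw [show r * d ^ 2 = (r * d) * d by ring] at h5
  exact Nat.dvd_of_mul_dvd_mul_left hs h5

theorem max_split (K L D : Type) [Field K] [Field L] [Algebra K L] [FiniteDimensional K L]
    [DivisionRing D] [Algebra K D] [Algebra.IsCentral K D] [FiniteDimensional K D]
    [Module L D] [IsScalarTower K L D] [SMulCommClass L D D] [SMulCommClass D L D]
    (hmax : ∀ x : D, (∀ l : L, (l • (1 : D)) * x = x * (l • (1 : D))) → ∃ l : L, x = l • 1) :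
    Module.finrank K D = Module.finrank K L ^ 2 ∧
      Nonempty (L ⊗[K] D ≃ₐ[L]
        Matrix (Fin (Module.finrank K L)) (Fin (Module.finrank K L)) L) := by
  have hmul : ∀ (l : L) (d : D), l • d = d * (l • 1) := fun l d => by
    rw [mul_smul_comm, mul_one]
  let φ : L ⊗[K] D →ₐ[L] Module.End L D :=
    Algebra.TensorProduct.lift (Algebra.ofId L (Module.End L D)) (Algebra.lsmul K L D)
      (fun l d => Algebra.commutes l _)
  have hφ : ∀ l d x, φ (l ⊗ₜ d) x = l • (d * x) := fun l d x => by
    have : φ (l ⊗ₜ d) = Algebra.ofId L (Module.End L D) l * Algebra.lsmul K L D d :=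
      Algebra.TensorProduct.lift_tmul _ _ _ _ _
    rw [this]
    rfl
  have : Module.Finite L D := Module.Finite.of_restrictScalars_finite K L D
  have := tensor_simple K L D
  have hinj : Function.Injective φ := φ.toRingHom.injective
  have hsurj : Function.Surjective φ := by
    intro f
    let ψ : L ⊗[K] D →ₐ[K] Module.End K D :=
      AlgHom.ofLinearMap
        { toFun := fun t => (φ t).restrictScalars K
          map_add' := fun x y => by ext; simp
          map_smul' := fun k x => by
            ext y
            simp only [LinearMap.restrictScalars_apply, RingHom.id_apply, LinearMap.smul_apply]
            rw [← algebraMap_smul L k x, map_smul, LinearMap.smul_apply, algebraMap_smul] }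
      (by ext; simp) (fun x y => by ext; simp)
    have hψ : ∀ t x, ψ t x = φ t x := fun _ _ => rfl
    obtain ⟨t, ht⟩ := density_hom ψ (f := f.restrictScalars K) (by
      intro W hW
      by_cases h0 : W = ⊥
      · exact Or.inl h0
      right
      obtain ⟨w, hw, hw0⟩ := Submodule.exists_mem_ne_zero_of_ne_bot h0
      rw [eq_top_iff]
      intro x _
      have := hW (1 ⊗ₜ (x * w⁻¹)) w hw
      rw [hψ, hφ] at this
      simpa [hw0] using this) (by
      intro g hg
      have h1 : ∀ (l : L) (d x : D), g (l • (d * x)) = l • (d * g x) := fun l d x => by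
        have := LinearMap.congr_fun (hg (l ⊗ₜ d)) x
        simpa [hψ, hφ] using this
      have h2 : ∀ d, g d = d * g 1 := fun d => by simpa using h1 1 d 1
      obtain ⟨l, hl⟩ := hmax (g 1) (fun l => by
        rw [← h2, ← hmul]
        simpa using h1 l 1 1)
      ext x
      simp only [Module.End.mul_apply, LinearMap.restrictScalars_apply]
      rw [h2, h2 x, hl, ← hmul, ← hmul, map_smul])
    refine ⟨t, LinearMap.ext fun x => ?_⟩
    exact LinearMap.congr_fun ht x
  let e : L ⊗[K] D ≃ₐ[L] Module.End L D := AlgEquiv.ofBijective φ ⟨hinj, hsurj⟩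
  let e2 := e.trans (algEquivMatrix (Module.finBasis L D))
  have h1 : Module.finrank K D = Module.finrank L D ^ 2 := by
    rw [← Module.finrank_baseChange (R := L), e2.toLinearEquiv.finrank_eq, Module.finrank_matrix,
      Fintype.card_fin, Module.finrank_self, mul_one, sq]
  have h2 := Module.finrank_mul_finrank K L D
  have h3 : 0 < Module.finrank L D := Module.finrank_pos
  have h4 : Module.finrank K L = Module.finrank L D := by
    rw [h1, sq] at h2
    exact Nat.eq_of_mul_eq_mul_right h3 h2
  rw [h4]
  exact ⟨h1, ⟨e2⟩⟩

lemma exists_max_comm (K D : Type) [Field K] [Ring D] [Algebra K D] [FiniteDimensional K D] :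
    ∃ L : Subalgebra K D, (∀ x ∈ L, ∀ y ∈ L, x * y = y * x) ∧
      ∀ x, (∀ y ∈ L, y * x = x * y) → x ∈ L := by
  let P : ℕ → Prop := fun n => ∃ L : Subalgebra K D, (∀ x ∈ L, ∀ y ∈ L, x * y = y * x) ∧
    Module.finrank K L = n
  have hP : ∃ n, P n := ⟨_, ⊥, by
    intro x hx y _
    obtain ⟨k, rfl⟩ := Algebra.mem_bot.1 hx
    exact Algebra.commutes k y, rfl⟩
  have hb : ∀ n, P n → n ≤ Module.finrank K D := by
    rintro n ⟨L, _, rfl⟩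
    exact Submodule.finrank_le L.toSubmodule
  classical
  obtain ⟨n0, h0⟩ := hP
  obtain ⟨L, hL, hn⟩ := Nat.findGreatest_spec (hb n0 h0) h0
  refine ⟨L, hL, fun x hx => ?_⟩
  let s : Set D := insert x (L : Set D)
  have hs : ∀ a ∈ s, ∀ b ∈ s, a * b = b * a := by
    rintro a (rfl | ha) b (rfl | hb')
    · rfl
    · exact (hx b hb').symm
    · exact hx a ha
    · exact hL a ha b hb'
  let M := Algebra.adjoin K s
  have hM : ∀ a ∈ M, ∀ b ∈ M, a * b = b * a := by
    intro a ha b hb'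
    have := Algebra.isMulCommutative_adjoin K hs
    exact congrArg Subtype.val (mul_comm' (⟨a, ha⟩ : Algebra.adjoin K s) ⟨b, hb'⟩)
  have hLM : L ≤ M := fun y hy => Algebra.subset_adjoin (Set.mem_insert_of_mem _ hy)
  have hfin : Module.finrank K M ≤ Module.finrank K L := by
    rw [hn]
    exact Nat.le_findGreatest (hb _ ⟨M, hM, rfl⟩) ⟨M, hM, rfl⟩
  have : L.toSubmodule = M.toSubmodule :=
    Submodule.eq_of_le_of_finrank_le hLM hfin
  have hx' : x ∈ M.toSubmodule := Algebra.subset_adjoin (Set.mem_insert _ _)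
  rw [← this] at hx'
  exact hx'

theorem exists_splitting (K D : Type) [Field K] 
    [DivisionRing D] [Algebra K D] [Algebra.IsCentral K D] [FiniteDimensional K D] :
    ∃ (L : Type) (_ : Field L) (_ : Algebra K L) (_ : FiniteDimensional K L),
      Module.finrank K D = Module.finrank K L ^ 2 ∧
      Nonempty (L ⊗[K] D ≃ₐ[L]
        Matrix (Fin (Module.finrank K L)) (Fin (Module.finrank K L)) L) := by
  obtain ⟨L, hL, hmax⟩ := exists_max_comm K Dᵐᵒᵖ
  let _ : CommRing L := { (inferInstance : Ring L) with
    mul_comm := fun x y => Subtype.ext (hL x x.2 y y.2) }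
  let _ : Field L := fieldOfFiniteDimensional K L
  have hsm : ∀ (l : L) (d : D), l • d = d * l.1.unop := fun l d => rfl
  have : SMulCommClass L D D := ⟨fun l d x => by simp [hsm, mul_assoc]⟩
  have : SMulCommClass D L D := SMulCommClass.symm _ _ _
  have : IsScalarTower K L D := ⟨fun k l x => by simp [hsm]⟩
  refine ⟨L, inferInstance, inferInstance, inferInstance, max_split K L D ?_⟩
  intro x hx
  refine ⟨⟨MulOpposite.op x, hmax _ fun y hy => ?_⟩, by simp [hsm]⟩
  have := hx ⟨y, hy⟩
  simp [hsm] at this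
  apply MulOpposite.unop_injective
  simpa using this.symm

section pow
open PiTensorProduct

variable (K A : Type) [Field K] [Ring A] [Algebra K A]

lemma pow_add_equiv (m n : ℕ) :
    Nonempty (((⨂[K] _ : Fin m, A) ⊗[K] (⨂[K] _ : Fin n, A)) ≃ₐ[K] (⨂[K] _ : Fin (m + n), A)) := by
  let e : ((⨂[K] _ : Fin m, A) ⊗[K] (⨂[K] _ : Fin n, A)) ≃ₗ[K] (⨂[K] _ : Fin (m + n), A) :=
    (tmulEquiv K A).trans (reindex K (fun _ => A) finSumFinEquiv)
  have he : ∀ a b, e (tprod K a ⊗ₜ tprod K b) =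
      tprod K (fun i => Sum.elim a b (finSumFinEquiv.symm i)) := fun a b => by
    simp [e]
  refine ⟨AlgEquiv.ofLinearEquiv e ?_ ?_⟩
  · rw [Algebra.TensorProduct.one_def, PiTensorProduct.one_def, PiTensorProduct.one_def, he,
      PiTensorProduct.one_def]
    congr 1
    funext i
    rcases finSumFinEquiv.symm i with j | j <;> simp
  · have h := (LinearMap.map_mul_iff e.toLinearMap).2 (by
      ext a b c d
      simp only [LinearMap.compMultilinearMap_apply, LinearMap.compr₂_apply, LinearMap.compl₂_apply,
        LinearMap.comp_apply, TensorProduct.AlgebraTensorModule.curry_apply, 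
        TensorProduct.curry_apply, LinearMap.mul_apply', LinearMap.restrictScalars_apply,
        Algebra.TensorProduct.tmul_mul_tmul, LinearEquiv.coe_coe, tprod_mul_tprod, he]
      congr 1
      funext i
      simp only [Pi.mul_apply]
      rcases finSumFinEquiv.symm i with j | j <;> simp)
    exact h

lemma pow_one_equiv : Nonempty ((⨂[K] _ : Fin 1, A) ≃ₐ[K] A) := by
  let e : (⨂[K] _ : Fin 1, A) ≃ₗ[K] A := subsingletonEquiv (s := fun _ => A) (0 : Fin 1)
  have he : ∀ a, e (tprod K a) = a 0 := fun a => by simp [e]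
  refine ⟨AlgEquiv.ofLinearEquiv e ?_ ?_⟩
  · rw [PiTensorProduct.one_def, he]; rfl
  · have h := (LinearMap.map_mul_iff e.toLinearMap).2 (by
      ext a b
      simp only [LinearMap.compMultilinearMap_apply, LinearMap.compr₂_apply, LinearMap.compl₂_apply,
        LinearMap.comp_apply, 
        LinearMap.mul_apply', LinearEquiv.coe_coe, tprod_mul_tprod, he, Pi.mul_apply])
    exact h

lemma pow_zero_equiv : Nonempty ((⨂[K] _ : Fin 0, A) ≃ₐ[K] K) := by
  let e : (⨂[K] _ : Fin 0, A) ≃ₗ[K] K := isEmptyEquiv (Fin 0)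
  have he : ∀ a, e (tprod K a) = 1 := fun a => by simp [e]
  refine ⟨AlgEquiv.ofLinearEquiv e ?_ ?_⟩
  · rw [PiTensorProduct.one_def, he]
  · have h := (LinearMap.map_mul_iff e.toLinearMap).2 (by
      ext a b
      simp only [LinearMap.compMultilinearMap_apply, LinearMap.compr₂_apply, LinearMap.compl₂_apply,
        LinearMap.comp_apply, 
        LinearMap.mul_apply', LinearEquiv.coe_coe, tprod_mul_tprod, he, mul_one])
    exact h

lemma pow_succ_equiv (n : ℕ) :
    Nonempty ((⨂[K] _ : Fin (n + 1), A) ≃ₐ[K] (⨂[K] _ : Fin n, A) ⊗[K] A) := by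
  obtain ⟨e⟩ := pow_add_equiv K A n 1
  obtain ⟨f⟩ := pow_one_equiv K A
  exact ⟨e.symm.trans (Algebra.TensorProduct.congr AlgEquiv.refl f)⟩

lemma pow_mul_equiv (m n : ℕ) :
    Nonempty ((⨂[K] _ : Fin n, (⨂[K] _ : Fin m, A)) ≃ₐ[K] (⨂[K] _ : Fin (m * n), A)) := by
  induction n with
  | zero =>
    obtain ⟨e⟩ := pow_zero_equiv K (⨂[K] _ : Fin m, A)
    obtain ⟨f⟩ := pow_zero_equiv K A
    exact ⟨e.trans f.symm⟩
  | succ n ih =>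
    obtain ⟨e⟩ := ih
    obtain ⟨f⟩ := pow_succ_equiv K (⨂[K] _ : Fin m, A) n
    obtain ⟨g⟩ := pow_add_equiv K A (m * n) m
    exact ⟨(f.trans (Algebra.TensorProduct.congr e AlgEquiv.refl)).trans g⟩

lemma distrib_equiv (L B : Type) [Field L] [Algebra K L] [Ring B] [Algebra K B] :
    Nonempty (L ⊗[K] (A ⊗[K] B) ≃ₐ[L] (L ⊗[K] A) ⊗[L] (L ⊗[K] B)) := by
  let e := TensorProduct.AlgebraTensorModule.distribBaseChange K L A B
  have he : ∀ l a b, e (l ⊗ₜ (a ⊗ₜ b)) = (l ⊗ₜ a) ⊗ₜ (1 ⊗ₜ b) := fun l a b => by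
    simp [e, TensorProduct.AlgebraTensorModule.distribBaseChange]
  refine ⟨AlgEquiv.ofLinearEquiv e ?_ ?_⟩
  · rw [Algebra.TensorProduct.one_def, Algebra.TensorProduct.one_def, he]; rfl
  · have h := (LinearMap.map_mul_iff e.toLinearMap).2 (by
      ext a b c d
      simp [he])
    exact h

lemma pow_baseChange (L : Type) [Field L] [Algebra K L] (n : ℕ) :
    Nonempty (L ⊗[K] (⨂[K] _ : Fin n, A) ≃ₐ[L] (⨂[L] _ : Fin n, L ⊗[K] A)) := by
  induction n with
  | zero =>
    obtain ⟨e⟩ := pow_zero_equiv K A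
    obtain ⟨f⟩ := pow_zero_equiv L (L ⊗[K] A)
    exact ⟨((Algebra.TensorProduct.congr (AlgEquiv.refl (R := L)) e).trans
      (Algebra.TensorProduct.rid K L L)).trans f.symm⟩
  | succ n ih =>
    obtain ⟨g⟩ := ih
    obtain ⟨e⟩ := pow_succ_equiv K A n
    obtain ⟨f⟩ := pow_succ_equiv L (L ⊗[K] A) n
    obtain ⟨d⟩ := distrib_equiv K (⨂[K] _ : Fin n, A) L A
    exact ⟨((Algebra.TensorProduct.congr (AlgEquiv.refl (R := L)) e).trans d).trans
      ((Algebra.TensorProduct.congr g AlgEquiv.refl).trans f.symm)⟩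

end pow

lemma IsCSA.mk' {K A : Type} [Field K] [Ring A] [Algebra K A] (h1 : Algebra.IsCentral K A)
    (h2 : IsSimpleRing A) (h3 : FiniteDimensional K A) : IsCSA K A :=
  ⟨Algebra.IsCentral.center_eq_bot K A, h2, h3⟩

lemma IsCSA.central {K A : Type} [Field K] [Ring A] [Algebra K A] (h : IsCSA K A) :
    Algebra.IsCentral K A := ⟨h.1.le⟩

lemma IsCSA.congr {K A B : Type} [Field K] [Ring A] [Algebra K A] [Ring B] [Algebra K B]
    (e : A ≃ₐ[K] B) (h : IsCSA K A) : IsCSA K B := by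
  have h1 := h.central
  have h2 := h.2.1
  have h3 := h.2.2
  exact IsCSA.mk' (Algebra.IsCentral.of_algEquiv K _ _ e)
    (IsSimpleRing.of_ringEquiv e.toRingEquiv h2) (Module.Finite.equiv e.toLinearEquiv)

lemma IsCSA.self (K : Type) [Field K] : IsCSA K K :=
  IsCSA.mk' inferInstance inferInstance inferInstance

lemma IsCSA.tensor {K A B : Type} [Field K] [Ring A] [Algebra K A] [Ring B] [Algebra K B]
    (hA : IsCSA K A) (hB : IsCSA K B) : IsCSA K (A ⊗[K] B) := by
  have h1 := hA.central
  have h2 := hA.2.1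
  have h3 := hA.2.2
  have h1' := hB.central
  have h2' := hB.2.1
  have h3' := hB.2.2
  exact IsCSA.mk' (tensor_central K A B) (tensor_simple K A B) inferInstance

lemma IsCSA.baseChange {K A : Type} [Field K] [Ring A] [Algebra K A]
    (hA : IsCSA K A) (L : Type) [Field L] [Algebra K L] : IsCSA L (L ⊗[K] A) := by
  have h1 := hA.central
  have h2 := hA.2.1
  have h3 := hA.2.2
  exact IsCSA.mk' (baseChange_central K A L) (tensor_simple K L A) inferInstance

lemma IsCSA.pow {K A : Type} [Field K] [Ring A] [Algebra K A]
    (hA : IsCSA K A) (n : ℕ) : IsCSA K (⨂[K] _ : Fin n, A) := by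
  induction n with
  | zero =>
    obtain ⟨e⟩ := pow_zero_equiv K A
    exact (IsCSA.self K).congr e.symm
  | succ n ih =>
    obtain ⟨e⟩ := pow_succ_equiv K A n
    exact (ih.tensor hA).congr e.symm

lemma central_of_matrix {K D : Type} [Field K] [Ring D] [Algebra K D] {r : ℕ} (hr : 0 < r)
    (h : Algebra.IsCentral K (Matrix (Fin r) (Fin r) D)) : Algebra.IsCentral K D := by
  have : Nonempty (Fin r) := ⟨⟨0, hr⟩⟩
  have : Algebra.IsCentral K (D ⊗[K] Matrix (Fin r) (Fin r) K) :=
    Algebra.IsCentral.of_algEquiv K _ _ (matrixEquivTensor (Fin r) K D)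
  exact Algebra.IsCentral.left_of_tensor_of_field K D (Matrix (Fin r) (Fin r) K)

lemma IsCSA.wedderburn {K A : Type} [Field K] [Ring A] [Algebra K A] (h : IsCSA K A) :
    ∃ (r : ℕ) (_ : 0 < r) (D : Type) (_ : DivisionRing D) (_ : Algebra K D)
      (_ : FiniteDimensional K D), Nonempty (A ≃ₐ[K] Matrix (Fin r) (Fin r) D) := by
  have h2 := h.2.1
  have h3 := h.2.2
  have : IsArtinianRing A := IsArtinianRing.of_finite K A
  obtain ⟨r, hr, D, i1, i2, i3, e⟩ :=
    IsSimpleRing.exists_algEquiv_matrix_divisionRing_finite K A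
  exact ⟨r, Nat.pos_of_ne_zero hr.out, D, i1, i2, i3, e⟩

/-- Iterated matrix algebras. -/
def matMat (K A : Type) [Field K] [Ring A] [Algebra K A] (a b : ℕ) :
    Matrix (Fin a) (Fin a) (Matrix (Fin b) (Fin b) A) ≃ₐ[K]
      Matrix (Fin (a * b)) (Fin (a * b)) A :=
  (Matrix.compAlgEquiv (Fin a) (Fin b) A K).trans
    (Matrix.reindexAlgEquiv K A finProdFinEquiv)

lemma IsSplit.congr {K A B : Type} [Field K] [Ring A] [Algebra K A] [Ring B] [Algebra K B]
    (e : A ≃ₐ[K] B) (h : IsSplit K A) : IsSplit K B := by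
  obtain ⟨n, hn, ⟨f⟩⟩ := h
  exact ⟨n, hn, ⟨e.symm.trans f⟩⟩

lemma IsSplit.self (K : Type) [Field K] : IsSplit K K :=
  ⟨1, one_pos, ⟨AlgEquiv.ofBijective (Algebra.ofId K (Matrix (Fin 1) (Fin 1) K))
    ⟨(algebraMap K (Matrix (Fin 1) (Fin 1) K)).injective, fun M => ⟨M 0 0, by
      ext i j
      fin_cases i
      fin_cases j
      simp [Algebra.ofId_apply, Matrix.algebraMap_matrix_apply]⟩⟩⟩⟩

lemma IsSplit.matrix {K A : Type} [Field K] [Ring A] [Algebra K A]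
    (h : IsSplit K A) {r : ℕ} (hr : 0 < r) : IsSplit K (Matrix (Fin r) (Fin r) A) := by
  obtain ⟨n, hn, ⟨f⟩⟩ := h
  exact ⟨r * n, by positivity, ⟨f.mapMatrix.trans (matMat K K r n)⟩⟩

lemma IsSplit.tensor {K A B : Type} [Field K] [Ring A] [Algebra K A] [Ring B] [Algebra K B]
    (hA : IsSplit K A) (hB : IsSplit K B) : IsSplit K (A ⊗[K] B) := by
  obtain ⟨n, hn, ⟨f⟩⟩ := hB
  exact (hA.matrix hn).congr ((matrixEquivTensor (Fin n) K A).trans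
    (Algebra.TensorProduct.congr AlgEquiv.refl f.symm))

lemma IsSplit.pow {K A : Type} [Field K] [Ring A] [Algebra K A]
    (hA : IsSplit K A) (n : ℕ) : IsSplit K (⨂[K] _ : Fin n, A) := by
  induction n with
  | zero =>
    obtain ⟨e⟩ := pow_zero_equiv K A
    exact (IsSplit.self K).congr e.symm
  | succ n ih =>
    obtain ⟨e⟩ := pow_succ_equiv K A n
    exact (ih.tensor hA).congr e.symm

lemma matrix_baseChange (K L D : Type) [Field K] [Field L] [Algebra K L] [Ring D] [Algebra K D]
    (n : ℕ) : Nonempty (L ⊗[K] Matrix (Fin n) (Fin n) D ≃ₐ[L]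
      Matrix (Fin n) (Fin n) (L ⊗[K] D)) := by
  let e1 : L ⊗[K] Matrix (Fin n) (Fin n) D ≃ₐ[L] L ⊗[K] (D ⊗[K] Matrix (Fin n) (Fin n) K) :=
    Algebra.TensorProduct.congr (AlgEquiv.refl (R := L)) (matrixEquivTensor (Fin n) K D)
  let e2 : (L ⊗[K] D) ⊗[K] Matrix (Fin n) (Fin n) K ≃ₐ[L]
      L ⊗[K] (D ⊗[K] Matrix (Fin n) (Fin n) K) :=
    Algebra.TensorProduct.assoc K K L L D (Matrix (Fin n) (Fin n) K)
  let e3 : (L ⊗[K] D) ⊗[K] Matrix (Fin n) (Fin n) K ≃ₐ[L] Matrix (Fin n) (Fin n) (L ⊗[K] D) :=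
    AlgEquiv.ofRingEquiv (f := (matrixEquivTensor (Fin n) K (L ⊗[K] D)).symm.toRingEquiv) (by
      intro l
      ext i j
      simp [Algebra.TensorProduct.algebraMap_apply, Matrix.algebraMap_matrix_apply,
        Matrix.one_apply, matrixEquivTensor_apply_symm])
  exact ⟨(e1.trans e2.symm).trans e3⟩

lemma IsSplit.baseChange {K A : Type} [Field K] [Ring A] [Algebra K A]
    (h : IsSplit K A) (L : Type) [Field L] [Algebra K L] : IsSplit L (L ⊗[K] A) := by
  obtain ⟨n, hn, ⟨f⟩⟩ := h
  obtain ⟨g⟩ := matrix_baseChange K L K n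
  exact ⟨n, hn, ⟨((Algebra.TensorProduct.congr (AlgEquiv.refl (R := L)) f).trans g).trans
    (Algebra.TensorProduct.rid K L L).mapMatrix⟩⟩

lemma IsSplit.cancel {K X Y : Type} [Field K] [Ring X] [Algebra K X] [Ring Y] [Algebra K Y]
    (hX : IsSplit K X) (hY : IsCSA K Y) (h : IsSplit K (X ⊗[K] Y)) : IsSplit K Y := by
  obtain ⟨a, ha, ⟨e⟩⟩ := hX
  obtain ⟨s, hs, ⟨f⟩⟩ := h
  obtain ⟨t, ht, D, _, _, _, ⟨g⟩⟩ := hY.wedderburn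
  let e1 : X ⊗[K] Y ≃ₐ[K] Matrix (Fin (a * t)) (Fin (a * t)) D :=
    ((Algebra.TensorProduct.comm K X Y).trans
      ((Algebra.TensorProduct.congr AlgEquiv.refl e).trans
        (matrixEquivTensor (Fin a) K Y).symm)).trans
      (g.mapMatrix.trans (matMat K D a t))
  obtain ⟨d, hd, hd1⟩ := split_deg (L := K) (by positivity) hs e1
    ((Algebra.TensorProduct.lid K (X ⊗[K] Y)).trans f)
  rw [Module.finrank_self, Nat.dvd_one] at hd1
  subst hd1
  rw [one_pow] at hd
  have hb : Function.Bijective (Algebra.ofId K D) := by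
    refine ⟨(algebraMap K D).injective, fun x => ?_⟩
    obtain ⟨c, hc⟩ := (finrank_eq_one_iff_of_nonzero' (1 : D) one_ne_zero).1 hd x
    exact ⟨c, by rw [← hc, Algebra.ofId_apply, Algebra.algebraMap_eq_smul_one]⟩
  exact ⟨t, ht, ⟨g.trans (AlgEquiv.ofBijective _ hb).symm.mapMatrix⟩⟩

lemma period_prime {K B : Type} [Field K] [Ring B] [Algebra K B] (hB : IsCSA K B)
    (p : ℕ) (hp : p.Prime) (h : IsSplit K (⨂[K] _ : Fin p, B)) :
    IsSplit K B ∨ period K B = p := by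
  have hne : {n : ℕ | 0 < n ∧ IsSplit K (⨂[K] _ : Fin n, B)}.Nonempty := ⟨p, hp.pos, h⟩
  obtain ⟨hq0, hq⟩ := Nat.sInf_mem hne
  have hmin : ∀ n, 0 < n → IsSplit K (⨂[K] _ : Fin n, B) → period K B ≤ n :=
    fun n h1 h2 => Nat.sInf_le ⟨h1, h2⟩
  change 0 < period K B at hq0
  change IsSplit K (⨂[K] _ : Fin (period K B), B) at hq
  generalize period K B = q at *
  have hdvd : q ∣ p := by
    rw [Nat.dvd_iff_mod_eq_zero]
    by_contra hr
    have h1 : IsSplit K (⨂[K] _ : Fin (q * (p / q)), B) := by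
      obtain ⟨e⟩ := pow_mul_equiv K B q (p / q)
      exact (hq.pow _).congr e
    obtain ⟨e⟩ := pow_add_equiv K B (q * (p / q)) (p % q)
    rw [← Nat.div_add_mod p q] at h
    have h2 := h1.cancel (hB.pow (p % q)) (h.congr e.symm)
    have := hmin _ (Nat.pos_of_ne_zero hr) h2
    exact absurd (Nat.mod_lt p hq0) (by omega)
  rcases (Nat.dvd_prime hp).1 hdvd with rfl | rfl
  · left
    obtain ⟨e⟩ := pow_one_equiv K B
    exact hq.congr e
  · right; rfl

/-- Transitivity of base change. -/
def cancelBC (E L M A : Type) [Field E] [Field L] [Field M] [Algebra E L] [Algebra L M]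
    [Algebra E M] [IsScalarTower E L M] [Ring A] [Algebra E A] :
    M ⊗[L] (L ⊗[E] A) ≃ₐ[M] M ⊗[E] A :=
  AlgEquiv.symm <| AlgEquiv.ofLinearEquiv
    (TensorProduct.AlgebraTensorModule.cancelBaseChange E L M M A).symm
    (by simp [Algebra.TensorProduct.one_def]) <|
      LinearMap.map_mul_of_map_mul_tmul (fun _ _ _ _ ↦ by simp)

theorem main_step
    (F : Type) [Field F] (p : ℕ) (hp : p.Prime) (m : ℕ)
    (h : ∀ (E : Type) [Field E] [Algebra F E] [FiniteDimensional F E]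
      (A : Type) [Ring A] [Algebra E A],
        IsCSA E A → period E A = p → index E A ∣ p ^ m) (n : ℕ) :
    ∀ (E : Type) [Field E] [Algebra F E] [FiniteDimensional F E] (A : Type) [Ring A] [Algebra E A],
      IsCSA E A → IsSplit E (⨂[E] _ : Fin (p ^ n), A) →
      ∃ (L : Type) (_ : Field L) (_ : Algebra E L) (_ : FiniteDimensional E L),
        Module.finrank E L ∣ p ^ (m * n) ∧ IsSplit L (L ⊗[E] A) := by
  induction n with
  | zero =>
    intro E _ _ _ A _ _ hA hs
    obtain ⟨e⟩ := pow_one_equiv E A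
    rw [pow_zero] at hs
    exact ⟨E, inferInstance, inferInstance, inferInstance, by simp, (hs.congr e).baseChange E⟩
  | succ n ih =>
    intro E _ _ _ A _ _ hA hs
    have hB := hA.pow (p ^ n)
    have hBp : IsSplit E (⨂[E] _ : Fin p, (⨂[E] _ : Fin (p ^ n), A)) := by
      obtain ⟨e⟩ := pow_mul_equiv E A (p ^ n) p
      rw [pow_succ] at hs
      exact hs.congr e.symm
    rcases period_prime hB p hp hBp with h1 | h1
    · obtain ⟨L, i1, i2, i3, h2, h3⟩ := ih E A hA h1
      exact ⟨L, i1, i2, i3, h2.trans (pow_dvd_pow p (by gcongr; omega)), h3⟩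
    have hidx := h E _ hB h1
    have hidx0 : index E (⨂[E] _ : Fin (p ^ n), A) ≠ 0 := by
      intro h0
      rw [h0, zero_dvd_iff] at hidx
      exact pow_ne_zero m hp.ne_zero hidx
    obtain ⟨D, _, _, r, hr, ⟨e⟩, hD⟩ := Nat.sInf_mem (Nat.nonempty_of_pos_sInf (Nat.pos_of_ne_zero hidx0))
    change Module.finrank E D = (index E (⨂[E] _ : Fin (p ^ n), A)) ^ 2 at hD
    have hDf : FiniteDimensional E D :=
      FiniteDimensional.of_finrank_pos (by rw [hD]; positivity)
    have hDc : Algebra.IsCentral E D := central_of_matrix hr (hB.congr e).central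
    obtain ⟨L, _, _, _, hL, ⟨f⟩⟩ := exists_splitting E D
    have hLi : Module.finrank E L = index E (⨂[E] _ : Fin (p ^ n), A) := by
      rw [hD] at hL
      exact (Nat.pow_left_injective two_ne_zero hL).symm
    have hLD : IsSplit L (L ⊗[E] D) := ⟨_, Module.finrank_pos, ⟨f⟩⟩
    have hLB : IsSplit L (L ⊗[E] (⨂[E] _ : Fin (p ^ n), A)) := by
      obtain ⟨g⟩ := matrix_baseChange E L D r
      exact (hLD.matrix hr).congr
        (g.symm.trans (Algebra.TensorProduct.congr (AlgEquiv.refl (R := L)) e.symm))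
    have hLA : IsSplit L (⨂[L] _ : Fin (p ^ n), L ⊗[E] A) := by
      obtain ⟨g⟩ := pow_baseChange E A L (p ^ n)
      exact hLB.congr g
    let _ : Algebra F L := ((algebraMap E L).comp (algebraMap F E)).toAlgebra
    have : IsScalarTower F E L := IsScalarTower.of_algebraMap_eq fun _ => rfl
    have : FiniteDimensional F L := FiniteDimensional.trans F E L
    obtain ⟨M, _, _, _, hM, hMs⟩ := ih L (L ⊗[E] A) (hA.baseChange L) hLA
    let _ : Algebra E M := ((algebraMap L M).comp (algebraMap E L)).toAlgebra
    have : IsScalarTower E L M := IsScalarTower.of_algebraMap_eq fun _ => rfl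
    refine ⟨M, inferInstance, inferInstance, FiniteDimensional.trans E L M, ?_, ?_⟩
    · rw [← Module.finrank_mul_finrank E L M, mul_add, mul_one, add_comm, pow_add, hLi]
      exact mul_dvd_mul hidx hM
    · exact hMs.congr (cancelBC E L M A)

/-- Let `F` be a field, `p` a prime, and `m ≥ 1`.  Suppose that for
every finite field extension `E/F`, every central simple `E`-algebra of period `p` has
index dividing `p^m`.  Then for every `n ≥ 1`, every central simple `F`-algebra of
period `p^n` has index dividing `p^{mn}`. -/
theorem index_bound_of_index_bound_for_period_p
    (F : Type) [Field F] (p : ℕ) [Fact p.Prime] (m : ℕ) (hm : 1 ≤ m)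
    (h : ∀ (E : Type) [Field E] [Algebra F E] [FiniteDimensional F E]
      (A : Type) [Ring A] [Algebra E A],
        IsCSA E A → period E A = p → index E A ∣ p ^ m) :
    ∀ (n : ℕ), 1 ≤ n → ∀ (A : Type) [Ring A] [Algebra F A],
      IsCSA F A → period F A = p ^ n → index F A ∣ p ^ (m * n) := by
  intro n _ A _ _ hA hper
  have hp : p.Prime := Fact.out
  have hper0 : period F A ≠ 0 := by rw [hper]; exact pow_ne_zero n hp.ne_zero
  have hs : IsSplit F (⨂[F] _ : Fin (p ^ n), A) := by
    have := (Nat.sInf_mem (Nat.nonempty_of_pos_sInf (Nat.pos_of_ne_zero hper0))).2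
    change IsSplit F (⨂[F] _ : Fin (period F A), A) at this
    rwa [hper] at this
  obtain ⟨L, _, _, _, hL, s, hs0, ⟨f⟩⟩ := main_step F p hp m h n F A hA hs
  have hne : {d : ℕ | ∃ (D : Type) (_ : DivisionRing D) (_ : Algebra F D) (r : ℕ), 0 < r ∧
      Nonempty (A ≃ₐ[F] Matrix (Fin r) (Fin r) D) ∧ Module.finrank F D = d ^ 2}.Nonempty := by
    obtain ⟨r, hr, D, i1, i2, _, ⟨e⟩⟩ := hA.wedderburn
    obtain ⟨d, hd, _⟩ := split_deg hr hs0 e f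
    exact ⟨d, D, i1, i2, r, hr, ⟨e⟩, hd⟩
  obtain ⟨D, i1, i2, r, hr, ⟨e⟩, hD⟩ := Nat.sInf_mem hne
  change Module.finrank F D = (index F A) ^ 2 at hD
  obtain ⟨d, hd, hdL⟩ := split_deg hr hs0 e f
  rw [hD] at hd
  rw [Nat.pow_left_injective two_ne_zero hd]
  exact hdL.trans hL
end
end

section
/- Let B be a regular local ring with maximal ideal m and residue field κ, let n be a natural number, and let u ∈ B be a unit such that the polynomial X^n − ū is irreducible over κ, i.e. [κ(ū^{1/n}) : κ] = n. Then B[u^{1/n}] := B[X]/(X^n − u) is a regular local ring with residue field κ(ū^{1/n}). -/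
noncomputable section

/-- A regular local ring: a Noetherian local ring whose maximal ideal can be generated
by a family of `d` elements where `d` is the Krull dimension (equivalently, the Krull
dimension equals the minimal number of generators of the maximal ideal). -/
def IsRegularLocal (B : Type) [CommRing B] : Prop :=
  IsNoetherianRing B ∧ ∃ _ : IsLocalRing B, ∃ s : Finset B,
    Ideal.span (s : Set B) = IsLocalRing.maximalIdeal B ∧
    (s.card : WithBot (WithTop ℕ)) = ringKrullDim B

/-- Let `B` be a regular local ring with residue field `κ`, `n` a
natural number and `u ∈ B` a unit such that `X^n - ū` is irreducible over `κ` (i.e.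
`[κ(ū^{1/n}) : κ] = n`).  Then `B[u^{1/n}] = B[X]/(X^n - u)` is a regular local ring
with residue field `κ(ū^{1/n}) = κ[X]/(X^n - ū)` (compatibly with the reduction
maps). -/
theorem adjoin_nth_root_of_unit_regular_local
    (B : Type) [CommRing B] [IsLocalRing B] (hB : IsRegularLocal B)
    (n : ℕ) (u : B) (hu : IsUnit u)
    (hirr : Irreducible (Polynomial.X ^ n -
      Polynomial.C (IsLocalRing.residue B u) :
        Polynomial (IsLocalRing.ResidueField B))) :
    IsRegularLocal (AdjoinRoot (Polynomial.X ^ n - Polynomial.C u)) ∧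
    ∃ (_ : IsLocalRing (AdjoinRoot (Polynomial.X ^ n - Polynomial.C u)))
      (e : IsLocalRing.ResidueField (AdjoinRoot (Polynomial.X ^ n - Polynomial.C u)) ≃+*
        AdjoinRoot (Polynomial.X ^ n - Polynomial.C (IsLocalRing.residue B u) :
          Polynomial (IsLocalRing.ResidueField B))),
      ∀ b : B, e (IsLocalRing.residue _ (algebraMap B _ b)) =
        algebraMap (IsLocalRing.ResidueField B) _ (IsLocalRing.residue B b) := by
  obtain ⟨hN, _, s, hs, hcard⟩ := hB
  have hn : n ≠ 0 := by
    rintro rfl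
    have h1 : (Polynomial.X ^ 0 - Polynomial.C (IsLocalRing.residue B u) :
        Polynomial (IsLocalRing.ResidueField B)) =
        Polynomial.C (1 - IsLocalRing.residue B u) := by simp
    rw [h1] at hirr
    have h2 : (1 - IsLocalRing.residue B u) ≠ 0 := by
      intro h; rw [h] at hirr; simp at hirr
    exact hirr.not_isUnit (Polynomial.isUnit_C.mpr h2.isUnit)
  have hmap : (Polynomial.X ^ n - Polynomial.C u : Polynomial B).map (IsLocalRing.residue B) =
      Polynomial.X ^ n - Polynomial.C (IsLocalRing.residue B u) := by simp
  rw [← hmap] at hirr ⊢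
  have hmonic : (Polynomial.X ^ n - Polynomial.C u : Polynomial B).Monic :=
    Polynomial.monic_X_pow_sub_C u hn
  generalize (Polynomial.X ^ n - Polynomial.C u : Polynomial B) = f at *
  have := hmonic.finite_adjoinRoot
  have := hmonic.free_adjoinRoot
  have hNS : IsNoetherianRing (AdjoinRoot f) := IsNoetherianRing.of_finite B _
  let e := AdjoinRoot.quotAdjoinRootEquivQuotPolynomialQuot (IsLocalRing.maximalIdeal B) f
  let e' : (AdjoinRoot f ⧸ (IsLocalRing.maximalIdeal B).map (AdjoinRoot.of f)) ≃+*
    AdjoinRoot (f.map (IsLocalRing.residue B)) := e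
  have : Fact (Irreducible (f.map (IsLocalRing.residue B))) := ⟨hirr⟩
  have hM : ((IsLocalRing.maximalIdeal B).map (AdjoinRoot.of f)).IsMaximal :=
    Ideal.Quotient.maximal_of_isField _ (e'.toMulEquiv.isField (Field.toIsField _))
  have huniq : ∀ J : Ideal (AdjoinRoot f), J.IsMaximal →
      J = (IsLocalRing.maximalIdeal B).map (AdjoinRoot.of f) := by
    intro J hJ
    have h1 : (J.comap (algebraMap B (AdjoinRoot f))).IsMaximal :=
      Ideal.isMaximal_comap_of_isIntegral_of_isMaximal J
    have h2 := IsLocalRing.eq_maximalIdeal h1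
    exact (hM.eq_of_le hJ.ne_top (Ideal.map_le_iff_le_comap.mpr h2.ge)).symm
  have hloc : IsLocalRing (AdjoinRoot f) := IsLocalRing.of_unique_max_ideal ⟨_, hM, huniq⟩
  have hmax := huniq _ (IsLocalRing.maximalIdeal.isMaximal (AdjoinRoot f))
  have hinj : Function.Injective (algebraMap B (AdjoinRoot f)) :=
    FaithfulSMul.algebraMap_injective B (AdjoinRoot f)
  have hlo : (IsLocalRing.maximalIdeal (AdjoinRoot f)).LiesOver (IsLocalRing.maximalIdeal B) :=
    ⟨(IsLocalRing.eq_maximalIdeal (Ideal.isMaximal_comap_of_isIntegral_of_isMaximal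
      (R := B) (IsLocalRing.maximalIdeal (AdjoinRoot f)))).symm⟩
  refine ⟨⟨hNS, hloc, s.map ⟨_, hinj⟩, ?_, ?_⟩, hloc,
    (Ideal.quotEquivOfEq hmax).trans e', ?_⟩
  · rw [hmax, ← hs, Ideal.map_span]
    simp [AdjoinRoot.algebraMap_eq]
  · rw [Finset.card_map, hcard, ← IsLocalRing.maximalIdeal_height_eq_ringKrullDim,
      ← IsLocalRing.maximalIdeal_height_eq_ringKrullDim,
      Ideal.height_eq_height_add_of_liesOver_of_hasGoingDown (IsLocalRing.maximalIdeal B)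
        (IsLocalRing.maximalIdeal (AdjoinRoot f))]
    have h0 : (IsLocalRing.maximalIdeal (AdjoinRoot f)).map (Ideal.Quotient.mk
      ((IsLocalRing.maximalIdeal B).map (algebraMap B (AdjoinRoot f)))) = ⊥ := by
      rw [hmax]; exact Ideal.map_quotient_self _
    have : Nontrivial (AdjoinRoot f ⧸
      ((IsLocalRing.maximalIdeal B).map (algebraMap B (AdjoinRoot f)))) :=
      Ideal.Quotient.nontrivial_iff.mpr hM.ne_top
    rw [h0, Ideal.height_bot, add_zero]
  · intro b
    change e (Ideal.Quotient.mk _ (AdjoinRoot.mk f (Polynomial.C b))) = _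
    rw [AdjoinRoot.quotAdjoinRootEquivQuotPolynomialQuot_mk_of, Polynomial.map_C]
    rfl
end
end

section
/- Let B be a regular local ring with maximal ideal m and residue field κ, and let π ∈ m be a regular prime, i.e. a prime element of B with π ∈ m ∖ m². Then for every natural number n, B[π^{1/n}] := B[X]/(X^n − π) is a regular local ring with residue field κ. -/
noncomputable section

open Polynomial in
lemma main_aux
    (B : Type) [CommRing B] [IsLocalRing B] [IsNoetherianRing B] (s : Finset B)
    (hs : Ideal.span (s : Set B) = IsLocalRing.maximalIdeal B)
    (hcard : (s.card : WithBot (WithTop ℕ)) = ringKrullDim B)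
    (π : B) (hmem : π ∈ IsLocalRing.maximalIdeal B)
    (hnotsq : π ∉ IsLocalRing.maximalIdeal B ^ 2)
    (n : ℕ) (hn : 0 < n) :
    IsRegularLocal (AdjoinRoot (X ^ n - C π)) ∧
    ∃ (_ : IsLocalRing (AdjoinRoot (X ^ n - C π)))
      (e : IsLocalRing.ResidueField (AdjoinRoot (X ^ n - C π)) ≃+*
        IsLocalRing.ResidueField B),
      ∀ b : B, e (IsLocalRing.residue _ (algebraMap B _ b)) = IsLocalRing.residue B b := by
  classical
  have hmonic : (X ^ n - C π : B[X]).Monic := monic_X_pow_sub_C π hn.ne'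
  have hrootpow : (AdjoinRoot.root (X ^ n - C π)) ^ n
      = algebraMap B (AdjoinRoot (X ^ n - C π)) π := by
    have h := AdjoinRoot.eval₂_root (X ^ n - C π)
    rw [eval₂_sub, eval₂_X_pow, eval₂_C, sub_eq_zero] at h
    exact h
  have hev : (X ^ n - C π : B[X]).eval₂ (IsLocalRing.residue B) 0 = 0 := by
    rw [eval₂_sub, eval₂_X_pow, eval₂_C, zero_pow hn.ne',
      (IsLocalRing.residue_eq_zero_iff π).2 hmem, sub_zero]
  let φ : AdjoinRoot (X ^ n - C π) →+* IsLocalRing.ResidueField B :=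
    AdjoinRoot.lift (IsLocalRing.residue B) 0 hev
  have hφb : ∀ b : B, φ (algebraMap B _ b) = IsLocalRing.residue B b := fun b =>
    AdjoinRoot.lift_of hev
  have hφr : φ (AdjoinRoot.root _) = 0 := AdjoinRoot.lift_root hev
  have hφs : Function.Surjective φ := fun y => by
    obtain ⟨b, rfl⟩ := IsLocalRing.residue_surjective y
    exact ⟨_, hφb b⟩
  have : Module.Finite B (AdjoinRoot (X ^ n - C π)) := hmonic.finite_adjoinRoot
  have : Module.Free B (AdjoinRoot (X ^ n - C π)) := hmonic.free_adjoinRoot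
  have hfree2 : Algebra.IsIntegral B (AdjoinRoot (X ^ n - C π)) := inferInstance
  -- the exchange step
  obtain ⟨a, has, u, hu, hπ⟩ : ∃ a ∈ s, ∃ u : B, IsUnit u ∧
      π - u * a ∈ Ideal.span ((s.erase a : Finset B) : Set B) := by
    have h := hmem
    rw [← hs] at h
    obtain ⟨f, -, hf⟩ := Submodule.mem_span_finset.1 h
    by_cases hall : ∀ a ∈ s, f a ∈ IsLocalRing.maximalIdeal B
    · refine absurd ?_ hnotsq
      rw [← hf, pow_two]
      refine Ideal.sum_mem _ fun a ha => Ideal.mul_mem_mul (hall a ha) ?_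
      rw [← hs]
      exact Ideal.subset_span ha
    · push Not at hall
      obtain ⟨a, ha, hfa⟩ := hall
      refine ⟨a, ha, f a, ?_, ?_⟩
      · simpa [IsLocalRing.mem_maximalIdeal] using hfa
      · rw [← hf, ← Finset.add_sum_erase s _ ha, smul_eq_mul, add_sub_cancel_left]
        exact Ideal.sum_mem _ fun b hb => Ideal.mul_mem_left _ _ (Ideal.subset_span hb)
  let T : Finset (AdjoinRoot (X ^ n - C π)) :=
    insert (AdjoinRoot.root _) ((s.erase a).image (algebraMap B _))
  have hTcard : T.card ≤ s.card := by
    refine (Finset.card_insert_le _ _).trans ?_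
    have h1 := Finset.card_image_le (s := s.erase a)
      (f := algebraMap B (AdjoinRoot (X ^ n - C π)))
    have h2 := Finset.card_erase_add_one has
    omega
  have hTroot : AdjoinRoot.root _ ∈ Ideal.span (T : Set (AdjoinRoot (X ^ n - C π))) :=
    Ideal.subset_span (by simp [T])
  have hTm : IsLocalRing.maximalIdeal B ≤
      (Ideal.span (T : Set (AdjoinRoot (X ^ n - C π)))).comap (algebraMap B _) := by
    have herase : Ideal.span ((s.erase a : Finset B) : Set B) ≤
        (Ideal.span (T : Set (AdjoinRoot (X ^ n - C π)))).comap (algebraMap B _) := by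
      rw [Ideal.span_le]
      intro b hb
      exact Ideal.subset_span (Finset.mem_coe.2
        (Finset.mem_insert_of_mem (Finset.mem_image_of_mem _ hb)))
    have hπT : π ∈ (Ideal.span (T : Set (AdjoinRoot (X ^ n - C π)))).comap
        (algebraMap B _) := by
      rw [Ideal.mem_comap, ← hrootpow]
      exact Ideal.pow_mem_of_mem _ hTroot n hn
    rw [← hs, Ideal.span_le]
    intro b hb
    by_cases hba : b = a
    · subst hba
      have h := Ideal.sub_mem _ hπT (herase hπ)
      rw [sub_sub_cancel] at h
      exact (Ideal.unit_mul_mem_iff_mem _ hu).1 h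
    · exact herase (Ideal.subset_span (by simpa [hba] using hb))
  have hker : RingHom.ker φ = Ideal.span (T : Set (AdjoinRoot (X ^ n - C π))) := by
    apply le_antisymm
    · intro y hy
      obtain ⟨p, rfl⟩ := AdjoinRoot.mk_surjective y
      rw [RingHom.mem_ker] at hy
      have hp := divX_mul_X_add p
      have hmk : AdjoinRoot.mk (X ^ n - C π) p =
          AdjoinRoot.mk _ p.divX * AdjoinRoot.root _ + algebraMap B _ (p.coeff 0) := by
        conv_lhs => rw [← hp]
        rw [map_add, map_mul]
        rfl
      rw [hmk, map_add, map_mul, hφr, mul_zero, zero_add, hφb,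
        IsLocalRing.residue_eq_zero_iff] at hy
      rw [hmk]
      exact Ideal.add_mem _ (Ideal.mul_mem_left _ _ hTroot) (hTm hy)
    · rw [Ideal.span_le]
      intro y hy
      rcases Finset.mem_insert.1 (Finset.mem_coe.1 hy) with rfl | hy
      · exact hφr
      · obtain ⟨b, hb, rfl⟩ := Finset.mem_image.1 hy
        change φ _ = 0
        rw [hφb, IsLocalRing.residue_eq_zero_iff, ← hs]
        exact Ideal.subset_span (Finset.mem_of_mem_erase hb)
  have hkermax : (RingHom.ker φ).IsMaximal := RingHom.ker_isMaximal_of_surjective φ hφs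
  have hloc : IsLocalRing (AdjoinRoot (X ^ n - C π)) := by
    refine IsLocalRing.of_unique_max_ideal ⟨RingHom.ker φ, hkermax, fun M hM => ?_⟩
    refine (hkermax.eq_of_le hM.ne_top ?_).symm
    have hc : M.comap (algebraMap B _) = IsLocalRing.maximalIdeal B :=
      IsLocalRing.eq_maximalIdeal (Ideal.isMaximal_comap_of_isIntegral_of_isMaximal M)
    rw [hker, Ideal.span_le]
    intro y hy
    rcases Finset.mem_insert.1 (Finset.mem_coe.1 hy) with rfl | hy
    · refine hM.isPrime.mem_of_pow_mem n ?_
      rw [hrootpow, ← Ideal.mem_comap, hc]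
      exact hmem
    · obtain ⟨b, hb, rfl⟩ := Finset.mem_image.1 hy
      have : b ∈ M.comap (algebraMap B _) := by
        rw [hc, ← hs]
        exact Ideal.subset_span (Finset.mem_of_mem_erase hb)
      exact this
  have hmax : IsLocalRing.maximalIdeal (AdjoinRoot (X ^ n - C π)) = RingHom.ker φ :=
    (IsLocalRing.eq_maximalIdeal hkermax).symm
  have hc : (IsLocalRing.maximalIdeal (AdjoinRoot (X ^ n - C π))).comap (algebraMap B _)
      = IsLocalRing.maximalIdeal B :=
    IsLocalRing.eq_maximalIdeal (Ideal.isMaximal_comap_of_isIntegral_of_isMaximal _)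
  have hdim : ringKrullDim B ≤ ringKrullDim (AdjoinRoot (X ^ n - C π)) := by
    have hlo : (IsLocalRing.maximalIdeal (AdjoinRoot (X ^ n - C π))).LiesOver
        (IsLocalRing.maximalIdeal B) := ⟨hc.symm⟩
    rw [← IsLocalRing.maximalIdeal_height_eq_ringKrullDim,
      ← IsLocalRing.maximalIdeal_height_eq_ringKrullDim]
    rw [Ideal.height_eq_height_add_of_liesOver_of_hasGoingDown (IsLocalRing.maximalIdeal B)
      (IsLocalRing.maximalIdeal (AdjoinRoot (X ^ n - C π)))]
    exact WithBot.coe_le_coe.2 le_self_add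
  have hdim2 : ringKrullDim (AdjoinRoot (X ^ n - C π)) ≤ T.card := by
    refine (ringKrullDim_le_spanFinrank_maximalIdeal _).trans ?_
    rw [hmax, hker]
    have h := Submodule.spanFinrank_span_le_ncard_of_finite
      (R := AdjoinRoot (X ^ n - C π)) T.finite_toSet
    rw [Set.ncard_coe_finset] at h
    exact_mod_cast h
  refine ⟨⟨inferInstance, hloc, T, by rw [hmax, hker], le_antisymm ?_ hdim2⟩, hloc,
    (Ideal.quotEquivOfEq hmax).trans (RingHom.quotientKerEquivOfSurjective hφs), fun b => ?_⟩
  · refine le_trans ?_ (hcard.le.trans hdim)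
    exact_mod_cast hTcard
  · exact hφb b

/-- Let `B` be a regular local ring with maximal ideal `m` and residue
field `κ`, and let `π ∈ m` be a regular prime, i.e. a prime element of `B` with
`π ∈ m ∖ m²`.  Then for every natural number `n ≥ 1`, `B[π^{1/n}] = B[X]/(X^n - π)` is a
regular local ring with residue field `κ` (compatibly with the reduction maps). -/
theorem adjoin_nth_root_of_regular_prime_regular_local
    (B : Type) [CommRing B] [IsLocalRing B] (hB : IsRegularLocal B)
    (π : B) (hprime : Prime π)
    (hmem : π ∈ IsLocalRing.maximalIdeal B)
    (hnotsq : π ∉ IsLocalRing.maximalIdeal B ^ 2)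
    (n : ℕ) (hn : 0 < n) :
    IsRegularLocal (AdjoinRoot (Polynomial.X ^ n - Polynomial.C π)) ∧
    ∃ (_ : IsLocalRing (AdjoinRoot (Polynomial.X ^ n - Polynomial.C π)))
      (e : IsLocalRing.ResidueField (AdjoinRoot (Polynomial.X ^ n - Polynomial.C π)) ≃+*
        IsLocalRing.ResidueField B),
      ∀ b : B, e (IsLocalRing.residue _ (algebraMap B _ b)) = IsLocalRing.residue B b := by
  obtain ⟨hN, _, s, hs, hcard⟩ := hB
  exact main_aux B s hs hcard π hmem hnotsq n hn
end
end
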